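/- Let N ∈ ℕ, let λ_1, …, λ_N ∈ [0,1], and let φ_1, …, φ_N : ℕ → ℤ be asymptotically linearly independent sequences. Then the set of all T ∈ Aut([0,1], ℬ, μ) for which there exists a strictly increasing sequence (n_k)_{k∈ℕ} in ℕ such that for every j ∈ {1,…,N} and all measurable A, B ⊆ [0,1], lim_{k→∞} μ(A ∩ T^{−φ_j(n_k)} B) = (1 − λ_j) μ(A ∩ B) + λ_j μ(A) μ(B), is a dense G_δ subset of Aut([0,1], ℬ, μ) in the weak topology. -/

import Mathlib

open MeasureTheory Filter Topology

noncomputable section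

/-- An invertible Lebesgue-measure-preserving transformation of `[0,1]`. -/
structure Aut01 : Type where
  toEquiv : unitInterval ≃ unitInterval
  measurePreserving_toFun :
    MeasurePreserving toEquiv (volume : Measure unitInterval) volume
  measurePreserving_invFun :
    MeasurePreserving toEquiv.symm (volume : Measure unitInterval) volume

namespace Aut01

/-- The correlation `μ(A ∩ T^{-m} B)` (as a real number). -/
def corr (T : Aut01) (m : ℤ) (A B : Set unitInterval) : ℝ :=
  (volume (A ∩ ⇑(T.toEquiv ^ m : Equiv.Perm unitInterval) ⁻¹' B)).toReal

/-- The dyadic interval `[k/2^ℓ, (k+1)/2^ℓ)` of rank `ℓ`, as a subset of `[0,1]`. -/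
def dyadic (ℓ k : ℕ) : Set unitInterval :=
  {x | (k : ℝ) / 2 ^ ℓ ≤ (x : ℝ) ∧ (x : ℝ) < ((k : ℝ) + 1) / 2 ^ ℓ}

/-- The metric `∂(T,S) = Σ_{ℓ≥1} 2^{-2ℓ} Σ_{E of rank ℓ} μ(TE △ SE)` inducing the weak
topology on `Aut01`. -/
def wDist (T S : Aut01) : ℝ :=
  ∑' ℓ : ℕ,
    (1 / 2 ^ (2 * (ℓ + 1)) : ℝ) *
      ∑ k ∈ Finset.range (2 ^ (ℓ + 1)),
        (volume (symmDiff (T.toEquiv '' dyadic (ℓ + 1) k) (S.toEquiv '' dyadic (ℓ + 1) k))).toReal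

/-- The weak topology on `Aut01`, generated by the balls of the metric `wDist`. -/
instance : TopologicalSpace Aut01 :=
  TopologicalSpace.generateFrom
    {U | ∃ (T : Aut01) (ε : ℝ), 0 < ε ∧ U = {S | wDist T S < ε}}

/-- `T` is aperiodic: the set of periodic points has measure zero. -/
def Aperiodic (T : Aut01) : Prop :=
  volume {x : unitInterval |
    ∃ n : ℕ, 0 < n ∧ (T.toEquiv ^ n : Equiv.Perm unitInterval) x = x} = 0

/-- `T` is weakly mixing. -/
def WeaklyMixing (T : Aut01) : Prop :=
  ∀ A B : Set unitInterval, MeasurableSet A → MeasurableSet B →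
    Tendsto
      (fun M : ℕ =>
        (1 / (M : ℝ)) *
          ∑ n ∈ Finset.Icc 1 M,
            |T.corr (n : ℤ) A B - (volume A).toReal * (volume B).toReal|)
      atTop (𝓝 0)

end Aut01

section

open scoped unitInterval ENNReal


theorem unitInterval.exists_null_not_countable :
    ∃ C : Set I, MeasurableSet C ∧ volume C = 0 ∧ ¬ C.Countable := by
  have hI : ¬ Countable I := by
    rw [Set.countable_coe_iff]
    exact fun h => (Cardinal.Real.Icc_countable_iff.1 h).not_gt one_pos
  have hII : ¬ Countable (I × I) := fun h =>
    hI (Function.Injective.countable (f := fun x : I => (x, x)) fun x y h => (Prod.mk.inj h).1)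
  let e : I ≃ᵐ I × I := PolishSpace.measurableEquivOfNotCountable hI hII
  let A : I → Set I := fun t => (fun z => (e z).1) ⁻¹' {t}
  have hA : ∀ t, MeasurableSet (A t) := fun t =>
    (measurable_fst.comp e.measurable) (measurableSet_singleton t)
  have hcount := Measure.countable_meas_pos_of_disjoint_iUnion (μ := (volume : Measure I)) hA
    (fun s t hst => Set.disjoint_left.2 fun z hs ht => hst (hs.symm.trans ht))
  have : ∃ t, ¬ 0 < volume (A t) := by
    by_contra! h
    exact hI (Set.countable_univ_iff.1 (hcount.mono fun t _ => h t))
  obtain ⟨t, ht⟩ := this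
  refine ⟨A t, hA t, by simpa using ht, fun hc => hI ?_⟩
  have : Countable (A t) := hc
  refine Function.Injective.countable
    (f := fun s : I => (⟨e.symm (t, s), by simp [A]⟩ : A t)) fun r s h => ?_
  have := e.symm.injective (Subtype.ext_iff.1 h)
  exact (Prod.mk.inj this).2

namespace Aut01

/-- The transformation associated with a measurable equivalence preserving the measure. -/
def ofMeasurableEquiv (e : I ≃ᵐ I) (he : MeasurePreserving e (volume : Measure I) volume) :
    Aut01 where
  toEquiv := e.toEquiv
  measurePreserving_toFun := he
  measurePreserving_invFun := he.symm e

/-- A pair of measure-preserving maps that are inverse to each other almost everywhere agrees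
almost everywhere with an invertible measure-preserving transformation. -/
theorem exists_ae_eq {f g : I → I} (hf : MeasurePreserving f (volume : Measure I) volume)
    (hg : MeasurePreserving g (volume : Measure I) volume)
    (hgf : ∀ᵐ x : I, g (f x) = x) (hfg : ∀ᵐ x : I, f (g x) = x) :
    ∃ T : Aut01, T.toEquiv =ᵐ[(volume : Measure I)] f ∧
      T.toEquiv.symm =ᵐ[(volume : Measure I)] g := by
  classical
  obtain ⟨C, hC, hC0, hCc⟩ := unitInterval.exists_null_not_countable
  let X : Set I := {x | g (f x) = x ∧ x ∉ C ∧ f x ∉ C}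
  let Y : Set I := {y | f (g y) = y ∧ y ∉ C ∧ g y ∉ C}
  have hX : MeasurableSet X :=
    (measurableSet_eq_fun (hg.measurable.comp hf.measurable) measurable_id).inter
      (hC.compl.inter (hf.measurable hC.compl))
  have hY : MeasurableSet Y :=
    (measurableSet_eq_fun (hf.measurable.comp hg.measurable) measurable_id).inter
      (hC.compl.inter (hg.measurable hC.compl))
  have hCae : ∀ᵐ x : I, x ∉ C := measure_eq_zero_iff_ae_notMem.1 hC0
  have hXae : ∀ᵐ x, x ∈ X := by
    filter_upwards [hgf, hCae, hf.quasiMeasurePreserving.ae hCae] with x h1 h2 h3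
      using ⟨h1, h2, h3⟩
  have hYae : ∀ᵐ x, x ∈ Y := by
    filter_upwards [hfg, hCae, hg.quasiMeasurePreserving.ae hCae] with x h1 h2 h3
      using ⟨h1, h2, h3⟩
  have hfXY : ∀ x : X, f x ∈ Y := fun ⟨x, h1, h2, h3⟩ => ⟨congrArg f h1, h3, by rwa [h1]⟩
  have hgYX : ∀ y : Y, g y ∈ X := fun ⟨y, h1, h2, h3⟩ => ⟨congrArg g h1, h3, by rwa [h1]⟩
  let E : X ≃ᵐ Y :=
    { toFun := fun x => ⟨f x, hfXY x⟩
      invFun := fun y => ⟨g y, hgYX y⟩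
      left_inv := fun x => Subtype.ext x.2.1
      right_inv := fun y => Subtype.ext y.2.1
      measurable_toFun := (hf.measurable.comp measurable_subtype_coe).subtype_mk (h := hfXY)
      measurable_invFun := (hg.measurable.comp measurable_subtype_coe).subtype_mk (h := hgYX) }
  have hXc : ¬ Countable ↥Xᶜ := fun h =>
    hCc ((Set.countable_coe_iff.1 h).mono (fun x hx hxX => hxX.2.1 hx : C ⊆ Xᶜ))
  have hYc : ¬ Countable ↥Yᶜ := fun h =>
    hCc ((Set.countable_coe_iff.1 h).mono (fun x hx hxX => hxX.2.1 hx : C ⊆ Yᶜ))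
  have := hX.compl.standardBorel
  have := hY.compl.standardBorel
  let φ : ↥Xᶜ ≃ᵐ ↥Yᶜ := PolishSpace.measurableEquivOfNotCountable hXc hYc
  let e : I ≃ᵐ I := (MeasurableEquiv.sumCompl hX).symm.trans
    ((MeasurableEquiv.sumCongr E φ).trans (MeasurableEquiv.sumCompl hY))
  have heX : ∀ x ∈ X, e x = f x := by
    intro x hx
    have : (MeasurableEquiv.sumCompl hX).symm x = Sum.inl ⟨x, hx⟩ :=
      Equiv.Set.sumCompl_symm_apply_of_mem hx
    simp only [e, MeasurableEquiv.trans_apply, this]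
    rfl
  have hef : e =ᵐ[(volume : Measure I)] f := by
    filter_upwards [hXae] with x hx using heX x hx
  have he : MeasurePreserving e (volume : Measure I) volume :=
    ⟨e.measurable, by rw [Measure.map_congr hef, hf.map_eq]⟩
  refine ⟨ofMeasurableEquiv e he, hef, ?_⟩
  filter_upwards [hYae] with y hy
  obtain ⟨h1, h2, h3⟩ := hy
  have : e (g y) = y := by
    rw [heX _ ⟨congrArg g h1, h3, by rwa [h1]⟩, h1]
  exact (Equiv.symm_apply_eq e.toEquiv).2 this.symm

end Aut01

theorem ContinuousMap.exists_abs_sub_le_add_mul_dist {X : Type*} [PseudoMetricSpace X]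
    [CompactSpace X] (h : C(X, ℝ)) {ε : ℝ} (hε : 0 < ε) :
    ∃ C : ℝ, 0 ≤ C ∧ ∀ x y, |h x - h y| ≤ ε + C * dist x y := by
  obtain ⟨δ, hδ, H⟩ := Metric.uniformContinuous_iff.1
    (CompactSpace.uniformContinuous_of_continuous h.continuous) ε hε
  refine ⟨2 * ‖h‖ / δ, by positivity, fun x y => ?_⟩
  rcases lt_or_ge (dist x y) δ with hxy | hxy
  · have := (H hxy).le
    rw [Real.dist_eq] at this
    have : 0 ≤ 2 * ‖h‖ / δ * dist x y := by positivity
    linarith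
  · have h1 : |h x - h y| ≤ 2 * ‖h‖ := by
      rw [← Real.dist_eq]
      exact h.dist_le_two_norm x y
    have h2 : 2 * ‖h‖ ≤ 2 * ‖h‖ / δ * dist x y := by
      rw [div_mul_eq_mul_div, le_div_iff₀ hδ]
      exact mul_le_mul_of_nonneg_left hxy (by positivity)
    linarith

theorem unitInterval.integrable_dist {α : Type*} [MeasurableSpace α] {μ : Measure α}
    [IsFiniteMeasure μ] {f g : α → I} (hf : AEMeasurable f μ) (hg : AEMeasurable g μ) :
    Integrable (fun x => dist (f x) (g x)) μ := by
  refine Integrable.of_bound (hf.dist hg).aestronglyMeasurable 1 (Eventually.of_forall fun x => ?_)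
  rw [Real.norm_eq_abs, abs_of_nonneg dist_nonneg, Subtype.dist_eq, Real.dist_eq, abs_le]
  have := (f x).2
  have := (g x).2
  constructor <;> linarith [(f x).2.1, (f x).2.2, (g x).2.1, (g x).2.2]

theorem unitInterval.exists_integral_abs_comp_sub_le_of_continuous (h : C(I, ℝ)) {ε : ℝ}
    (hε : 0 < ε) :
    ∃ C : ℝ, 0 ≤ C ∧ ∀ f g : I → I, Measurable f → Measurable g →
      ∫ x, |h (f x) - h (g x)| ≤ ε + C * ∫ x, dist (f x) (g x) := by
  obtain ⟨C, hC, H⟩ := h.exists_abs_sub_le_add_mul_dist hε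
  refine ⟨C, hC, fun f g hf hg => ?_⟩
  have hi := integrable_dist (μ := volume) hf.aemeasurable hg.aemeasurable
  calc ∫ x, |h (f x) - h (g x)| ≤ ∫ x, (ε + C * dist (f x) (g x)) :=
        integral_mono_of_nonneg (Eventually.of_forall fun _ => abs_nonneg _)
          ((integrable_const ε).add (hi.const_mul C)) (Eventually.of_forall fun _ => H _ _)
    _ = _ := by
        rw [integral_add (integrable_const ε) (hi.const_mul C), integral_const_mul]
        simp

/-- Composition with measure-preserving maps is continuous in mean, uniformly over the maps. -/
theorem unitInterval.exists_integral_abs_comp_sub_le {u : I → ℝ} (hu : Integrable u) {ε : ℝ}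
    (hε : 0 < ε) :
    ∃ C : ℝ, 0 ≤ C ∧ ∀ f g : I → I, MeasurePreserving f (volume : Measure I) volume →
      MeasurePreserving g (volume : Measure I) volume →
      ∫ x, |u (f x) - u (g x)| ≤ ε + C * ∫ x, dist (f x) (g x) := by
  obtain ⟨h, hh, hhi⟩ := hu.exists_boundedContinuous_integral_sub_le
    (show (0 : ℝ) < ε / 3 by positivity)
  obtain ⟨C, hC, H⟩ := exists_integral_abs_comp_sub_le_of_continuous h.toContinuousMap
    (show (0 : ℝ) < ε / 3 by positivity)
  refine ⟨C, hC, fun f g hf hg => ?_⟩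
  have hd : Integrable (fun x => |u x - h x|) := (hu.sub hhi).abs
  have key : ∀ f : I → I, MeasurePreserving f (volume : Measure I) volume →
      Integrable (fun x => |u (f x) - h (f x)|) ∧ ∫ x, |u (f x) - h (f x)| ≤ ε / 3 := by
    intro f hf
    refine ⟨hf.integrable_comp_of_integrable hd, ?_⟩
    rw [← hf.map_eq, integral_map hf.measurable.aemeasurable
      (by rw [hf.map_eq]; exact hd.aestronglyMeasurable)] at hh
    simpa using hh
  have hhc : Integrable (fun x => |h (f x) - h (g x)|) :=
    ((hf.integrable_comp_of_integrable hhi).sub (hg.integrable_comp_of_integrable hhi)).abs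
  have h3 := H f g hf.measurable hg.measurable
  calc ∫ x, |u (f x) - u (g x)|
      ≤ ∫ x, (|u (f x) - h (f x)| + |h (f x) - h (g x)| + |u (g x) - h (g x)|) := by
        refine integral_mono_of_nonneg (Eventually.of_forall fun _ => abs_nonneg _)
          (((key f hf).1.add hhc).add (key g hg).1) (Eventually.of_forall fun x => ?_)
        have h1 := abs_add_three (u (f x) - h (f x)) (h (f x) - h (g x)) (h (g x) - u (g x))
        have h2 : |h (g x) - u (g x)| = |u (g x) - h (g x)| := abs_sub_comm _ _
        rw [h2] at h1
        simpa using h1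
    _ = (∫ x, |u (f x) - h (f x)|) + (∫ x, |h (f x) - h (g x)|) + ∫ x, |u (g x) - h (g x)| := by
        rw [← integral_add (key f hf).1 hhc, ← integral_add _ (key g hg).1]
        exact (key f hf).1.add hhc
    _ ≤ ε + C * ∫ x, dist (f x) (g x) := by
        have h3' : ∫ x, |h (f x) - h (g x)| ≤ ε / 3 + C * ∫ x, dist (f x) (g x) := h3
        linarith [(key f hf).2, (key g hg).2]

theorem measureReal_symmDiff_preimage {α β : Type*} [MeasurableSpace α] [MeasurableSpace β]
    {μ : Measure α} [IsFiniteMeasure μ] {f g : α → β} {E : Set β} (hf : MeasurableSet (f ⁻¹' E))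
    (hg : MeasurableSet (g ⁻¹' E)) :
    μ.real (symmDiff (f ⁻¹' E) (g ⁻¹' E)) =
      ∫ x, |E.indicator 1 (f x) - E.indicator (1 : β → ℝ) (g x)| ∂μ := by
  rw [← integral_indicator_one (hf.symmDiff hg)]
  congr 1 with x
  by_cases h1 : f x ∈ E <;> by_cases h2 : g x ∈ E <;>
    simp [Set.indicator, Set.mem_symmDiff, h1, h2]

theorem unitInterval.exists_measureReal_symmDiff_preimage_le {E : Set I} (hE : MeasurableSet E)
    {ε : ℝ} (hε : 0 < ε) :
    ∃ C : ℝ, 0 ≤ C ∧ ∀ f g : I → I, MeasurePreserving f (volume : Measure I) volume →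
      MeasurePreserving g (volume : Measure I) volume →
      volume.real (symmDiff (f ⁻¹' E) (g ⁻¹' E)) ≤ ε + C * ∫ x, dist (f x) (g x) := by
  obtain ⟨C, hC, H⟩ := exists_integral_abs_comp_sub_le
    (u := E.indicator 1) ((integrable_const (1 : ℝ)).indicator hE) hε
  refine ⟨C, hC, fun f g hf hg => ?_⟩
  rw [measureReal_symmDiff_preimage (hf.measurable hE) (hg.measurable hE)]
  exact H f g hf hg

/-- Convergence in mean of self-maps of the unit interval. -/
def TendstoInMean {ι : Type*} (f : ι → I → I) (l : Filter ι) (g : I → I) : Prop :=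
  Tendsto (fun i => ∫ x, dist (f i x) (g x)) l (𝓝 0)

theorem tendsto_zero_of_forall_le_add_mul {ι : Type*} {l : Filter ι} {a d : ι → ℝ}
    (ha : ∀ i, 0 ≤ a i) (hd : Tendsto d l (𝓝 0))
    (h : ∀ ε > 0, ∃ C : ℝ, ∀ i, a i ≤ ε + C * d i) : Tendsto a l (𝓝 0) := by
  rw [Metric.tendsto_nhds]
  intro ε hε
  obtain ⟨C, hC⟩ := h (ε / 2) (by positivity)
  have : Tendsto (fun i => C * d i) l (𝓝 0) := by simpa using hd.const_mul C
  filter_upwards [this.eventually_lt_const (show 0 < ε / 2 by positivity)] with i hi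
  rw [Real.dist_0_eq_abs, abs_of_nonneg (ha i)]
  linarith [hC i]

namespace TendstoInMean

variable {ι : Type*} {l : Filter ι} {f f' : ι → I → I} {g g' : I → I}

theorem integral_abs_comp (h : TendstoInMean f l g)
    (hf : ∀ i, MeasurePreserving (f i) (volume : Measure I) volume)
    (hg : MeasurePreserving g (volume : Measure I) volume) {u : I → ℝ} (hu : Integrable u) :
    Tendsto (fun i => ∫ x, |u (f i x) - u (g x)|) l (𝓝 0) := by
  refine tendsto_zero_of_forall_le_add_mul
    (fun i => integral_nonneg fun x => abs_nonneg _) h fun ε hε => ?_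
  obtain ⟨C, -, hC⟩ := unitInterval.exists_integral_abs_comp_sub_le hu hε
  exact ⟨C, fun i => hC _ _ (hf i) hg⟩

theorem measureReal_symmDiff (h : TendstoInMean f l g)
    (hf : ∀ i, MeasurePreserving (f i) (volume : Measure I) volume)
    (hg : MeasurePreserving g (volume : Measure I) volume) {E : Set I} (hE : MeasurableSet E) :
    Tendsto (fun i => volume.real (symmDiff (f i ⁻¹' E) (g ⁻¹' E))) l (𝓝 0) := by
  refine tendsto_zero_of_forall_le_add_mul (fun i => measureReal_nonneg) h fun ε hε => ?_
  obtain ⟨C, -, hC⟩ := unitInterval.exists_measureReal_symmDiff_preimage_le hE hε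
  exact ⟨C, fun i => hC _ _ (hf i) hg⟩

theorem comp_left (h' : TendstoInMean f' l g')
    (hf' : ∀ i, MeasurePreserving (f' i) (volume : Measure I) volume)
    (hg' : MeasurePreserving g' (volume : Measure I) volume) (hg : Measurable g) :
    TendstoInMean (fun i => g ∘ f' i) l (g ∘ g') := by
  have := h'.integral_abs_comp hf' hg' (u := fun x => (g x : ℝ))
    (Integrable.of_bound (measurable_subtype_coe.comp hg).aestronglyMeasurable 1
      (Eventually.of_forall fun x => by
        rw [Real.norm_eq_abs, abs_le]; constructor <;> linarith [(g x).2.1, (g x).2.2]))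
  exact this

theorem comp_right (h : TendstoInMean f l g) (hf : ∀ i, Measurable (f i)) (hg : Measurable g)
    (hf' : ∀ i, MeasurePreserving (f' i) (volume : Measure I) volume) :
    Tendsto (fun i => ∫ x, dist (f i (f' i x)) (g (f' i x))) l (𝓝 0) := by
  refine h.congr fun i => ?_
  nth_rw 1 [← (hf' i).map_eq]
  rw [integral_map (hf' i).measurable.aemeasurable
    ((hf i).dist hg).aestronglyMeasurable]

theorem comp (h : TendstoInMean f l g) (h' : TendstoInMean f' l g')
    (hf : ∀ i, Measurable (f i)) (hg : Measurable g)
    (hf' : ∀ i, MeasurePreserving (f' i) (volume : Measure I) volume)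
    (hg' : MeasurePreserving g' (volume : Measure I) volume) :
    TendstoInMean (fun i => f i ∘ f' i) l (g ∘ g') := by
  have h1 := (h.comp_right hf hg hf').add (h'.comp_left hf' hg' hg)
  rw [add_zero] at h1
  refine squeeze_zero (fun i => integral_nonneg fun x => dist_nonneg) (fun i => ?_) h1
  have i1 := unitInterval.integrable_dist (μ := volume)
    ((hf i).comp (hf' i).measurable).aemeasurable (hg.comp (hf' i).measurable).aemeasurable
  have i2 := unitInterval.integrable_dist (μ := volume)
    (hg.comp (hf' i).measurable).aemeasurable (hg.comp hg'.measurable).aemeasurable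
  exact (integral_mono_of_nonneg (Eventually.of_forall fun _ => dist_nonneg) (i1.add i2)
    (Eventually.of_forall fun x => dist_triangle _ _ _)).trans (integral_add i1 i2).le

theorem measurePreserving [NeBot l] (h : TendstoInMean f l g)
    (hf : ∀ i, MeasurePreserving (f i) (volume : Measure I) volume) (hg : Measurable g) :
    MeasurePreserving g (volume : Measure I) volume := by
  refine ⟨hg, ?_⟩
  have := Measure.isProbabilityMeasure_map (μ := (volume : Measure I)) hg.aemeasurable
  refine ext_of_forall_integral_eq_of_IsFiniteMeasure fun u => ?_
  rw [integral_map hg.aemeasurable u.continuous.aestronglyMeasurable]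
  have h1 : Tendsto (fun i => ∫ x, |u (f i x) - u (g x)|) l (𝓝 0) := by
    refine tendsto_zero_of_forall_le_add_mul
      (fun i => integral_nonneg fun x => abs_nonneg _) h fun ε hε => ?_
    obtain ⟨C, -, hC⟩ := unitInterval.exists_integral_abs_comp_sub_le_of_continuous
      u.toContinuousMap hε
    exact ⟨C, fun i => hC _ _ (hf i).measurable hg⟩
  have hi : ∀ {v : I → I}, Measurable v → Integrable (fun x => u (v x)) := fun {v} hv =>
    Integrable.of_bound (u.continuous.measurable.comp hv).aestronglyMeasurable ‖u‖
      (Eventually.of_forall fun x => u.norm_coe_le_norm _)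
  have h2 : ∀ i, |(∫ x, u x) - ∫ x, u (g x)| ≤ ∫ x, |u (f i x) - u (g x)| := by
    intro i
    have h3 : ∫ x, u x = ∫ x, u (f i x) := by
      nth_rw 1 [← (hf i).map_eq]
      rw [integral_map (hf i).measurable.aemeasurable u.continuous.aestronglyMeasurable]
    rw [h3, ← integral_sub (hi (hf i).measurable) (hi hg)]
    exact abs_integral_le_integral_abs
  have h4 : |(∫ x, u x) - ∫ x, u (g x)| ≤ 0 := ge_of_tendsto' h1 h2
  exact (sub_eq_zero.1 (abs_nonpos_iff.1 h4)).symm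

end TendstoInMean

namespace Aut01

theorem measurePreserving_pow (T : Aut01) (n : ℕ) :
    MeasurePreserving (T.toEquiv ^ n : Equiv.Perm I) (volume : Measure I) volume := by
  rw [Equiv.Perm.coe_pow]
  exact T.measurePreserving_toFun.iterate n

/-- The inverse transformation. -/
def symm (T : Aut01) : Aut01 where
  toEquiv := T.toEquiv.symm
  measurePreserving_toFun := T.measurePreserving_invFun
  measurePreserving_invFun := T.measurePreserving_toFun

theorem zpow_negSucc (T : Aut01) (n : ℕ) :
    (T.toEquiv ^ (Int.negSucc n) : Equiv.Perm I) = T.symm.toEquiv ^ (n + 1) := by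
  rw [_root_.zpow_negSucc, ← inv_pow]
  rfl

theorem measurePreserving_zpow (T : Aut01) (m : ℤ) :
    MeasurePreserving (T.toEquiv ^ m : Equiv.Perm I) (volume : Measure I) volume := by
  cases m with
  | ofNat n => simpa using T.measurePreserving_pow n
  | negSucc n => simpa only [zpow_negSucc] using T.symm.measurePreserving_pow (n + 1)

theorem measurable (T : Aut01) : Measurable T.toEquiv := T.measurePreserving_toFun.measurable

theorem measurable_symm (T : Aut01) : Measurable T.toEquiv.symm :=
  T.measurePreserving_invFun.measurable

theorem tendstoInMean_pow {l : Filter Aut01} {T : Aut01}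
    (h : TendstoInMean (fun S : Aut01 => S.toEquiv) l T.toEquiv) (n : ℕ) :
    TendstoInMean (fun S : Aut01 => (S.toEquiv ^ n : Equiv.Perm I)) l
      (T.toEquiv ^ n : Equiv.Perm I) := by
  induction n with
  | zero => simpa [TendstoInMean] using tendsto_const_nhds
  | succ n ih =>
    simp only [pow_succ, Equiv.Perm.coe_mul]
    exact ih.comp h (fun S => (S.measurePreserving_pow n).measurable)
      (T.measurePreserving_pow n).measurable (fun S => S.measurePreserving_toFun)
      T.measurePreserving_toFun

theorem tendstoInMean_zpow {l : Filter Aut01} {T : Aut01}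
    (h : TendstoInMean (fun S : Aut01 => S.toEquiv) l T.toEquiv)
    (h' : TendstoInMean (fun S : Aut01 => S.toEquiv.symm) l T.toEquiv.symm) (m : ℤ) :
    TendstoInMean (fun S : Aut01 => (S.toEquiv ^ m : Equiv.Perm I)) l
      (T.toEquiv ^ m : Equiv.Perm I) := by
  cases m with
  | ofNat n => simpa using tendstoInMean_pow h n
  | negSucc n =>
    simp only [zpow_negSucc]
    have h1 : TendstoInMean (fun S : Aut01 => S.toEquiv) (l.map symm) T.symm.toEquiv :=
      tendsto_map'_iff.2 h'
    exact tendsto_map'_iff.1 (tendstoInMean_pow h1 (n + 1))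

theorem tendstoInMean_of_symm {l : Filter Aut01} {T : Aut01}
    (h : TendstoInMean (fun S : Aut01 => S.toEquiv.symm) l T.toEquiv.symm) :
    TendstoInMean (fun S : Aut01 => S.toEquiv) l T.toEquiv := by
  refine (h.comp_left (fun S => S.measurePreserving_invFun) T.measurePreserving_invFun
    T.measurable).congr fun S => ?_
  have : ∫ x, dist (S.toEquiv x) (T.toEquiv x) =
      ∫ y, dist (S.toEquiv (S.toEquiv.symm y)) (T.toEquiv (S.toEquiv.symm y)) := by
    nth_rw 1 [← S.measurePreserving_invFun.map_eq]
    rw [integral_map S.measurable_symm.aemeasurable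
      (S.measurable.dist T.measurable).aestronglyMeasurable]
  rw [this]
  simp [dist_comm]

theorem tendsto_corr {l : Filter Aut01} {T : Aut01} {m : ℤ}
    (h : TendstoInMean (fun S : Aut01 => (S.toEquiv ^ m : Equiv.Perm I)) l
      (T.toEquiv ^ m : Equiv.Perm I)) {A B : Set I} (hA : MeasurableSet A)
    (hB : MeasurableSet B) :
    Tendsto (fun S : Aut01 => S.corr m A B) l (𝓝 (T.corr m A B)) := by
  rw [tendsto_iff_dist_tendsto_zero]
  refine squeeze_zero (fun _ => dist_nonneg) (fun S => ?_) (h.measureReal_symmDiff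
    (fun S => S.measurePreserving_zpow m) (T.measurePreserving_zpow m) hB)
  have h1 := (S.measurePreserving_zpow m).measurable hB
  have h2 := (T.measurePreserving_zpow m).measurable hB
  refine (abs_measureReal_sub_le_measureReal_symmDiff (hA.inter h1).nullMeasurableSet
    (hA.inter h2).nullMeasurableSet).trans (measureReal_mono ?_)
  rintro x (⟨⟨h1, h2⟩, h3⟩ | ⟨⟨h1, h2⟩, h3⟩)
  · exact Or.inl ⟨h2, fun h => h3 ⟨h1, h⟩⟩
  · exact Or.inr ⟨h2, fun h => h3 ⟨h1, h⟩⟩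

end Aut01

theorem unitInterval.integral_dist_triangle {α : Type*} [MeasurableSpace α] {μ : Measure α}
    [IsFiniteMeasure μ] {f g h : α → I} (hf : AEMeasurable f μ) (hg : AEMeasurable g μ)
    (hh : AEMeasurable h μ) :
    ∫ x, dist (f x) (h x) ∂μ ≤ (∫ x, dist (f x) (g x) ∂μ) + ∫ x, dist (g x) (h x) ∂μ := by
  have i1 := integrable_dist hf hg
  have i2 := integrable_dist hg hh
  exact (integral_mono_of_nonneg (Eventually.of_forall fun _ => dist_nonneg) (i1.add i2)
    (Eventually.of_forall fun x => dist_triangle _ _ _)).trans (integral_add i1 i2).le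

namespace Aut01

theorem measurableSet_dyadic (ℓ k : ℕ) : MeasurableSet (dyadic ℓ k) :=
  (measurableSet_le measurable_const measurable_subtype_coe).inter
    (measurableSet_lt measurable_subtype_coe measurable_const)

theorem mem_dyadic_iff {ℓ k : ℕ} {x : I} : x ∈ dyadic ℓ k ↔ ⌊(x : ℝ) * 2 ^ ℓ⌋₊ = k := by
  rw [Nat.floor_eq_iff (mul_nonneg x.2.1 (by positivity)), dyadic, Set.mem_ofPred_eq,
    div_le_iff₀ (by positivity), lt_div_iff₀ (by positivity)]

theorem floor_lt_two_pow {ℓ : ℕ} {x : I} (hx : x ≠ 1) : ⌊(x : ℝ) * 2 ^ ℓ⌋₊ < 2 ^ ℓ := by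
  rw [Nat.floor_lt (mul_nonneg x.2.1 (by positivity))]
  have : (x : ℝ) < 1 := lt_of_le_of_ne x.2.2 fun h => hx (Subtype.ext h)
  push_cast
  nlinarith [show (0 : ℝ) < 2 ^ ℓ by positivity]

theorem dist_le_of_mem_dyadic {ℓ k : ℕ} {x y : I} (hx : x ∈ dyadic ℓ k) (hy : y ∈ dyadic ℓ k) :
    dist x y ≤ (1 / 2) ^ ℓ := by
  have h : ((k : ℝ) + 1) / 2 ^ ℓ = k / 2 ^ ℓ + (1 / 2) ^ ℓ := by
    rw [add_div, one_div_pow]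
  obtain ⟨h1, h2⟩ := hx
  obtain ⟨h3, h4⟩ := hy
  rw [h] at h2 h4
  rw [Subtype.dist_eq, Real.dist_eq, abs_le]
  constructor <;> linarith

theorem image_eq_preimage_symm (T : Aut01) (E : Set I) :
    T.toEquiv '' E = T.toEquiv.symm ⁻¹' E :=
  T.toEquiv.image_eq_preimage_symm E

/-- The total displacement between `T` and `S` of the dyadic intervals of rank `ℓ`. -/
def dyadicDist (ℓ : ℕ) (T S : Aut01) : ℝ :=
  ∑ k ∈ Finset.range (2 ^ ℓ),
    volume.real (symmDiff (T.toEquiv.symm ⁻¹' dyadic ℓ k) (S.toEquiv.symm ⁻¹' dyadic ℓ k))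

theorem wDist_eq (T S : Aut01) :
    wDist T S = ∑' ℓ : ℕ, (1 / 2 ^ (2 * (ℓ + 1)) : ℝ) * dyadicDist (ℓ + 1) T S := by
  simp only [wDist, image_eq_preimage_symm, dyadicDist, Measure.real]

theorem dyadicDist_nonneg (ℓ : ℕ) (T S : Aut01) : 0 ≤ dyadicDist ℓ T S :=
  Finset.sum_nonneg fun _ _ => measureReal_nonneg

theorem mul_dyadicDist_le (ℓ : ℕ) (T S : Aut01) :
    (1 / 2 ^ (2 * ℓ) : ℝ) * dyadicDist ℓ T S ≤ (1 / 2) ^ ℓ := by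
  have h : dyadicDist ℓ T S ≤ 2 ^ ℓ := by
    refine (Finset.sum_le_card_nsmul _ _ 1 fun k _ => measureReal_le_one).trans ?_
    simp
  calc (1 / 2 ^ (2 * ℓ) : ℝ) * dyadicDist ℓ T S ≤ 1 / 2 ^ (2 * ℓ) * 2 ^ ℓ := by gcongr
    _ = (1 / 2) ^ ℓ := by
      rw [two_mul, pow_add, one_div_pow]; field_simp

theorem summable_half_pow_succ : Summable fun ℓ : ℕ => ((1 : ℝ) / 2) ^ (ℓ + 1) :=
  (summable_nat_add_iff 1).2 summable_geometric_two

theorem summable_dyadicDist (T S : Aut01) :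
    Summable fun ℓ : ℕ => (1 / 2 ^ (2 * (ℓ + 1)) : ℝ) * dyadicDist (ℓ + 1) T S :=
  Summable.of_nonneg_of_le
    (fun ℓ => mul_nonneg (by positivity) (dyadicDist_nonneg _ _ _))
    (fun ℓ => mul_dyadicDist_le _ _ _) summable_half_pow_succ

theorem wDist_nonneg (T S : Aut01) : 0 ≤ wDist T S := by
  rw [wDist_eq]
  exact tsum_nonneg fun ℓ => mul_nonneg (by positivity) (dyadicDist_nonneg _ _ _)

theorem wDist_self (T : Aut01) : wDist T T = 0 := by
  simp [wDist_eq, dyadicDist]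

theorem integral_dist_symm_le_dyadicDist (ℓ : ℕ) (T S : Aut01) :
    ∫ y, dist (S.toEquiv.symm y) (T.toEquiv.symm y) ≤ (1 / 2) ^ ℓ + dyadicDist ℓ T S := by
  let D : ℕ → Set I := fun k =>
    symmDiff (T.toEquiv.symm ⁻¹' dyadic ℓ k) (S.toEquiv.symm ⁻¹' dyadic ℓ k)
  have hD : ∀ k, MeasurableSet (D k) := fun k =>
    (T.measurable_symm (measurableSet_dyadic ℓ k)).symmDiff
      (S.measurable_symm (measurableSet_dyadic ℓ k))
  have hint : ∀ k, Integrable ((D k).indicator (1 : I → ℝ)) := fun k =>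
    (integrable_const (1 : ℝ)).indicator (hD k)
  have hsum : Integrable fun y => ∑ k ∈ Finset.range (2 ^ ℓ), (D k).indicator (1 : I → ℝ) y :=
    integrable_finsetSum _ fun k _ => hint k
  have hpt : ∀ᵐ y : I, dist (S.toEquiv.symm y) (T.toEquiv.symm y) ≤
      (1 / 2) ^ ℓ + ∑ k ∈ Finset.range (2 ^ ℓ), (D k).indicator (1 : I → ℝ) y := by
    have h1 : ∀ᵐ y : I, y ≠ 1 := by simp [ae_iff]
    filter_upwards [T.measurePreserving_invFun.quasiMeasurePreserving.ae h1] with y hy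
    by_cases h : S.toEquiv.symm y ∈ dyadic ℓ ⌊(T.toEquiv.symm y : ℝ) * 2 ^ ℓ⌋₊
    · have := dist_le_of_mem_dyadic h (mem_dyadic_iff.2 rfl)
      have : 0 ≤ ∑ k ∈ Finset.range (2 ^ ℓ), (D k).indicator (1 : I → ℝ) y :=
        Finset.sum_nonneg fun k _ => Set.indicator_nonneg (fun _ _ => zero_le_one) _
      linarith
    · have h2 : (D ⌊(T.toEquiv.symm y : ℝ) * 2 ^ ℓ⌋₊).indicator (1 : I → ℝ) y = 1 := by
        have : y ∈ D ⌊(T.toEquiv.symm y : ℝ) * 2 ^ ℓ⌋₊ := Or.inl ⟨mem_dyadic_iff.2 rfl, h⟩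
        rw [Set.indicator_of_mem this, Pi.one_apply]
      have h3 : (1 : ℝ) ≤ ∑ k ∈ Finset.range (2 ^ ℓ), (D k).indicator (1 : I → ℝ) y := by
        rw [← h2]
        exact Finset.single_le_sum (f := fun k => (D k).indicator (1 : I → ℝ) y)
          (fun k _ => Set.indicator_nonneg (fun _ _ => zero_le_one) _)
          (Finset.mem_range.2 (floor_lt_two_pow hy))
      have h4 : dist (S.toEquiv.symm y) (T.toEquiv.symm y) ≤ 1 := by
        rw [Subtype.dist_eq]
        exact Real.dist_le_of_mem_Icc_01 (Subtype.prop _) (Subtype.prop _)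
      have : (0 : ℝ) ≤ (1 / 2) ^ ℓ := by positivity
      linarith
  calc _ ≤ ∫ y, ((1 / 2 : ℝ) ^ ℓ + ∑ k ∈ Finset.range (2 ^ ℓ), (D k).indicator (1 : I → ℝ) y) :=
        integral_mono_of_nonneg (Eventually.of_forall fun _ => dist_nonneg)
          ((integrable_const _).add hsum) hpt
    _ = _ := by
        rw [integral_add (integrable_const _) hsum, integral_finsetSum _ fun k _ => hint k]
        simp [dyadicDist, integral_indicator_one (hD _), D]

theorem integral_dist_symm_le_wDist (ℓ : ℕ) (T S : Aut01) :
    ∫ y, dist (S.toEquiv.symm y) (T.toEquiv.symm y) ≤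
      (1 / 2) ^ (ℓ + 1) + 2 ^ (2 * (ℓ + 1)) * wDist T S := by
  refine (integral_dist_symm_le_dyadicDist (ℓ + 1) T S).trans (add_le_add_right ?_ _)
  have h := (summable_dyadicDist T S).le_tsum ℓ
    fun j _ => mul_nonneg (by positivity) (dyadicDist_nonneg _ _ _)
  rw [← wDist_eq] at h
  have := mul_le_mul_of_nonneg_left h (show (0 : ℝ) ≤ 2 ^ (2 * (ℓ + 1)) by positivity)
  rwa [← mul_assoc, mul_one_div_cancel (by positivity), one_mul] at this

theorem tendsto_wDist {l : Filter Aut01} {S : Aut01}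
    (h : TendstoInMean (fun R : Aut01 => R.toEquiv.symm) l S.toEquiv.symm) (T : Aut01) :
    Tendsto (fun R => wDist T R) l (𝓝 (wDist T S)) := by
  simp only [wDist_eq]
  refine tendsto_tsum_of_dominated_convergence summable_half_pow_succ (fun ℓ => ?_)
    (Eventually.of_forall fun R ℓ => ?_)
  · refine (tendsto_finsetSum _ fun k _ => ?_).const_mul _
    rw [tendsto_iff_dist_tendsto_zero]
    refine squeeze_zero (fun _ => dist_nonneg) (fun R => ?_) (h.measureReal_symmDiff
      (fun R => R.measurePreserving_invFun) S.measurePreserving_invFun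
      (measurableSet_dyadic (ℓ + 1) k))
    have hR := R.measurable_symm (measurableSet_dyadic (ℓ + 1) k)
    have hS := S.measurable_symm (measurableSet_dyadic (ℓ + 1) k)
    have hT := T.measurable_symm (measurableSet_dyadic (ℓ + 1) k)
    refine (abs_measureReal_sub_le_measureReal_symmDiff
      (hT.symmDiff hR).nullMeasurableSet (hT.symmDiff hS).nullMeasurableSet).trans
      (measureReal_mono ?_)
    rw [symmDiff_comm, symmDiff_assoc, symmDiff_comm, symmDiff_assoc]
    intro y
    simp only [Set.mem_symmDiff]
    tauto
  · rw [Real.norm_eq_abs, abs_of_nonneg (mul_nonneg (by positivity) (dyadicDist_nonneg _ _ _))]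
    exact mul_dyadicDist_le _ _ _

/-- The two-sided distance in mean. -/
@[reducible] def meanPseudoMetric : PseudoMetricSpace Aut01 where
  dist T S := (∫ x, dist (T.toEquiv x) (S.toEquiv x)) +
    ∫ x, dist (T.toEquiv.symm x) (S.toEquiv.symm x)
  dist_self T := by simp
  dist_comm T S := by simp only [dist_comm]
  dist_triangle T S R := by
    have h1 := unitInterval.integral_dist_triangle (μ := volume) T.measurable.aemeasurable
      S.measurable.aemeasurable R.measurable.aemeasurable
    have h2 := unitInterval.integral_dist_triangle (μ := volume) T.measurable_symm.aemeasurable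
      S.measurable_symm.aemeasurable R.measurable_symm.aemeasurable
    linarith

theorem tendsto_meanPseudoMetric_iff {ι : Type*} {l : Filter ι} {f : ι → Aut01} {T : Aut01} :
    Tendsto f l (@nhds _ meanPseudoMetric.toUniformSpace.toTopologicalSpace T) ↔
      TendstoInMean (fun i => (f i).toEquiv) l T.toEquiv ∧
      TendstoInMean (fun i => (f i).toEquiv.symm) l T.toEquiv.symm := by
  let := meanPseudoMetric
  rw [tendsto_iff_dist_tendsto_zero]
  refine ⟨fun h => ⟨?_, ?_⟩, fun h => ?_⟩
  · exact squeeze_zero (fun i => integral_nonneg fun x => dist_nonneg)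
      (fun i => le_add_of_nonneg_right (integral_nonneg fun x => dist_nonneg)) h
  · exact squeeze_zero (fun i => integral_nonneg fun x => dist_nonneg)
      (fun i => le_add_of_nonneg_left (integral_nonneg fun x => dist_nonneg)) h
  · have := h.1.add h.2
    rwa [add_zero] at this

theorem tendstoInMean_nhds_meanPseudoMetric (T : Aut01) :
    TendstoInMean (fun S : Aut01 => S.toEquiv)
        (@nhds _ meanPseudoMetric.toUniformSpace.toTopologicalSpace T) T.toEquiv ∧
      TendstoInMean (fun S : Aut01 => S.toEquiv.symm)
        (@nhds _ meanPseudoMetric.toUniformSpace.toTopologicalSpace T) T.toEquiv.symm :=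
  tendsto_meanPseudoMetric_iff.1 tendsto_id

theorem tendsto_meanPseudoMetric_of_symm {l : Filter Aut01} {T : Aut01}
    (h : TendstoInMean (fun S : Aut01 => S.toEquiv.symm) l T.toEquiv.symm) :
    l ≤ @nhds _ meanPseudoMetric.toUniformSpace.toTopologicalSpace T :=
  tendsto_meanPseudoMetric_iff.2 ⟨tendstoInMean_of_symm h, h⟩

theorem topology_eq : (inferInstance : TopologicalSpace Aut01) =
    meanPseudoMetric.toUniformSpace.toTopologicalSpace := by
  refine le_antisymm (le_of_nhds_le_nhds fun T => ?_) (le_generateFrom ?_)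
  · have h1 : 𝓝 T ≤ comap (wDist T) (𝓝 0) := by
      rw [← tendsto_iff_comap, Metric.tendsto_nhds]
      intro ε hε
      have : {S | wDist T S < ε} ∈ 𝓝 T :=
        (TopologicalSpace.isOpen_generateFrom_of_mem ⟨T, ε, hε, rfl⟩ :
          IsOpen {S | wDist T S < ε}).mem_nhds (by simpa [wDist_self] using hε)
      filter_upwards [this] with S hS
      rwa [Real.dist_0_eq_abs, abs_of_nonneg (wDist_nonneg T S)]
    refine h1.trans (tendsto_meanPseudoMetric_of_symm ?_)
    refine tendsto_zero_of_forall_le_add_mul (d := wDist T)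
      (fun _ => integral_nonneg fun _ => dist_nonneg) tendsto_comap fun ε hε => ?_
    obtain ⟨ℓ, hℓ⟩ := exists_pow_lt_of_lt_one hε (show (1 : ℝ) / 2 < 1 by norm_num)
    refine ⟨2 ^ (2 * (ℓ + 1)), fun S => (integral_dist_symm_le_wDist ℓ T S).trans ?_⟩
    have : ((1 : ℝ) / 2) ^ (ℓ + 1) ≤ (1 / 2) ^ ℓ :=
      pow_le_pow_of_le_one (by norm_num) (by norm_num) (Nat.le_succ ℓ)
    linarith
  · rintro U ⟨T, ε, hε, rfl⟩
    refine (@isOpen_iff_mem_nhds _ meanPseudoMetric.toUniformSpace.toTopologicalSpace _).2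
      fun S hS => ?_
    exact (tendsto_wDist (tendstoInMean_nhds_meanPseudoMetric S).2 T).eventually_lt_const hS

theorem tendstoInMean_nhds (T : Aut01) :
    TendstoInMean (fun S : Aut01 => S.toEquiv) (𝓝 T) T.toEquiv ∧
      TendstoInMean (fun S : Aut01 => S.toEquiv.symm) (𝓝 T) T.toEquiv.symm := by
  rw [show 𝓝 T = @nhds _ meanPseudoMetric.toUniformSpace.toTopologicalSpace T by
    rw [← topology_eq]]
  exact tendstoInMean_nhds_meanPseudoMetric T

theorem exists_integral_dist_symm_lt_imp_mem {T : Aut01} {U : Set Aut01} (hU : U ∈ 𝓝 T) :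
    ∃ ε > 0, ∀ S : Aut01,
      ∫ y, dist (S.toEquiv.symm y) (T.toEquiv.symm y) < ε → S ∈ U := by
  let d : Aut01 → ℝ := fun S => ∫ y, dist (S.toEquiv.symm y) (T.toEquiv.symm y)
  have h : comap d (𝓝 0) ≤ 𝓝 T := by
    rw [show 𝓝 T = @nhds _ meanPseudoMetric.toUniformSpace.toTopologicalSpace T by
      rw [← topology_eq]]
    exact tendsto_meanPseudoMetric_of_symm (tendsto_comap (f := d))
  obtain ⟨V, hV, hVU⟩ := mem_comap.1 (h hU)
  obtain ⟨ε, hε, H⟩ := Metric.mem_nhds_iff.1 hV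
  refine ⟨ε, hε, fun S hS => hVU (H ?_)⟩
  rw [Metric.mem_ball, Real.dist_0_eq_abs,
    abs_of_nonneg (integral_nonneg fun _ => dist_nonneg)]
  exact hS

theorem continuous_corr (m : ℤ) {A B : Set I} (hA : MeasurableSet A) (hB : MeasurableSet B) :
    Continuous fun T : Aut01 => T.corr m A B :=
  continuous_iff_continuousAt.2 fun T => tendsto_corr
    (tendstoInMean_zpow (tendstoInMean_nhds T).1 (tendstoInMean_nhds T).2 m) hA hB

/-- Sequences of maps that are Cauchy in mean converge in mean. -/
theorem exists_tendstoInMean_of_cauchySeq {f : ℕ → I → I} (hf : ∀ n, Measurable (f n))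
    (h : ∀ ε > 0, ∃ N, ∀ m ≥ N, ∀ n ≥ N, ∫ x, dist (f m x) (f n x) < ε) :
    ∃ g : I → I, Measurable g ∧ TendstoInMean f atTop g := by
  have hi : ∀ n, Integrable fun x => (f n x : ℝ) := fun n =>
    Integrable.of_bound (measurable_subtype_coe.comp (hf n)).aestronglyMeasurable 1
      (Eventually.of_forall fun x => by
        rw [Real.norm_eq_abs, abs_le]; constructor <;> linarith [(f n x).2.1, (f n x).2.2])
  let u : ℕ → I →₁[(volume : Measure I)] ℝ := fun n => (hi n).toL1 _
  have hd : ∀ v w : I → ℝ, ∀ hv : Integrable v, ∀ hw : Integrable w,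
      dist (hv.toL1 v) (hw.toL1 w) = ∫ x, |v x - w x| := by
    intro v w hv hw
    rw [dist_eq_norm, ← Integrable.toL1_sub, L1.norm_eq_integral_norm]
    refine integral_congr_ae ?_
    filter_upwards [(hv.sub hw).coeFn_toL1] with x hx
    rw [hx]
    rfl
  have hu : CauchySeq u := by
    rw [Metric.cauchySeq_iff]
    intro ε hε
    obtain ⟨N, hN⟩ := h ε hε
    refine ⟨N, fun m hm n hn => ?_⟩
    rw [hd]
    exact hN m hm n hn
  obtain ⟨a, ha⟩ := cauchySeq_tendsto_of_complete hu
  have ham := (L1.integrable_coeFn a).aestronglyMeasurable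
  refine ⟨fun x => Set.projIcc 0 1 zero_le_one (ham.mk a x),
    continuous_projIcc.measurable.comp ham.stronglyMeasurable_mk.measurable, ?_⟩
  have ha' := tendsto_iff_dist_tendsto_zero.1 ha
  refine squeeze_zero (fun n => integral_nonneg fun x => dist_nonneg) (fun n => ?_) ha'
  have hda : dist (u n) a = ∫ x, |(f n x : ℝ) - a x| := by
    nth_rw 1 [← Integrable.toL1_coeFn a (L1.integrable_coeFn a)]
    exact hd _ _ _ _
  rw [hda]
  refine integral_mono_of_nonneg (Eventually.of_forall fun _ => dist_nonneg)
    ((hi n).sub (L1.integrable_coeFn a)).abs ?_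
  filter_upwards [ham.ae_eq_mk] with x hx
  rw [hx]
  have h1 : f n x = Set.projIcc (0 : ℝ) 1 zero_le_one (f n x) := (Set.projIcc_val _ _).symm
  nth_rw 1 [h1]
  rw [Subtype.dist_eq]
  exact Set.abs_projIcc_sub_projIcc zero_le_one

theorem completeSpace_meanPseudoMetric :
    @CompleteSpace _ meanPseudoMetric.toUniformSpace := by
  let := meanPseudoMetric
  refine Metric.complete_of_cauchySeq_tendsto fun u hu => ?_
  rw [Metric.cauchySeq_iff] at hu
  obtain ⟨g, hgm, hg⟩ := exists_tendstoInMean_of_cauchySeq (fun n => (u n).measurable)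
    fun ε hε => (hu ε hε).imp fun N hN m hm n hn => lt_of_le_of_lt
      (le_add_of_nonneg_right (integral_nonneg fun x => dist_nonneg)) (hN m hm n hn)
  obtain ⟨f, hfm, hf⟩ := exists_tendstoInMean_of_cauchySeq (fun n => (u n).measurable_symm)
    fun ε hε => (hu ε hε).imp fun N hN m hm n hn => lt_of_le_of_lt
      (le_add_of_nonneg_left (integral_nonneg fun x => dist_nonneg)) (hN m hm n hn)
  have hg' := hg.measurePreserving (fun n => (u n).measurePreserving_toFun) hgm
  have hf' := hf.measurePreserving (fun n => (u n).measurePreserving_invFun) hfm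
  have key : ∀ v : I → I, Measurable v → TendstoInMean (fun _ : ℕ => id) atTop v →
      ∀ᵐ x, v x = x := by
    intro v hv h
    have h0 : ∫ x, dist (id x) (v x) = 0 := tendsto_nhds_unique tendsto_const_nhds h
    rw [integral_eq_zero_iff_of_nonneg (fun _ => dist_nonneg)
      (unitInterval.integrable_dist measurable_id.aemeasurable hv.aemeasurable)] at h0
    filter_upwards [h0] with x hx
    exact (dist_eq_zero.1 hx).symm
  have hgf : ∀ᵐ x, g (f x) = x := key (g ∘ f) (hgm.comp hfm) <| by
    refine (hg.comp hf (fun n => (u n).measurable) hgm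
      (fun n => (u n).measurePreserving_invFun) hf').congr fun n => ?_
    simp
  have hfg : ∀ᵐ x, f (g x) = x := key (f ∘ g) (hfm.comp hgm) <| by
    refine (hf.comp hg (fun n => (u n).measurable_symm) hfm
      (fun n => (u n).measurePreserving_toFun) hg').congr fun n => ?_
    simp
  obtain ⟨T, hTg, hTf⟩ := exists_ae_eq hg' hf' hfg hgf
  refine ⟨T, tendsto_meanPseudoMetric_iff.2 ⟨hg.congr fun n => ?_, hf.congr fun n => ?_⟩⟩
  · refine integral_congr_ae ?_
    filter_upwards [hTg] with x hx
    rw [hx]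
  · refine integral_congr_ae ?_
    filter_upwards [hTf] with x hx
    rw [hx]

instance : BaireSpace Aut01 := by
  have h : ∀ (X : Type) [PseudoMetricSpace X] [CompleteSpace X], BaireSpace X :=
    fun X => inferInstance
  have h' := @h Aut01 meanPseudoMetric completeSpace_meanPseudoMetric
  rwa [← topology_eq] at h'

end Aut01

/-- The uniform probability measure on `Fin q`. -/
def unifFin (q : ℕ) : Measure (Fin q) := (q : ℝ≥0∞)⁻¹ • Measure.count

theorem unifFin_apply {q : ℕ} (s : Finset (Fin q)) : unifFin q s = (q : ℝ≥0∞)⁻¹ * s.card := by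
  simp [unifFin]

instance (q : ℕ) [NeZero q] : IsProbabilityMeasure (unifFin q) :=
  ⟨by
    rw [← Finset.coe_univ, unifFin_apply, Finset.card_univ, Fintype.card_fin]
    exact ENNReal.inv_mul_cancel (by simp [NeZero.ne]) (by simp)⟩

theorem lintegral_unifFin {q : ℕ} (f : Fin q → ℝ≥0∞) :
    ∫⁻ i, f i ∂(unifFin q) = (q : ℝ≥0∞)⁻¹ * ∑ i, f i := by
  rw [unifFin, lintegral_smul_measure, lintegral_count, tsum_fintype, smul_eq_mul]

theorem measurePreserving_perm_unifFin {q : ℕ} (e : Equiv.Perm (Fin q)) :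
    MeasurePreserving e (unifFin q) (unifFin q) := by
  refine ⟨measurable_of_finite _, Measure.ext fun s _ => ?_⟩
  classical
  have : s = (s.toFinite.toFinset : Set (Fin q)) := by simp
  rw [Measure.map_apply (measurable_of_finite _) (Set.toFinite s).measurableSet, this,
    ← Finset.coe_preimage _ (e.injective.injOn), unifFin_apply, unifFin_apply,
    Finset.card_preimage]
  simp

namespace UnitAddCircle

/-- The representative in `[0,1)` of a point of the circle. -/
def rep (x : UnitAddCircle) : ℝ := AddCircle.equivIco 1 0 x

theorem rep_nonneg (x : UnitAddCircle) : 0 ≤ rep x := (AddCircle.equivIco 1 0 x).2.1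

theorem rep_lt_one (x : UnitAddCircle) : rep x < 1 :=
  (AddCircle.equivIco 1 0 x).2.2.trans_eq (zero_add 1)

@[simp]
theorem coe_rep (x : UnitAddCircle) : (rep x : UnitAddCircle) = x := AddCircle.coe_equivIco

theorem rep_coe (u : ℝ) : rep (u : UnitAddCircle) = Int.fract u := by
  have := AddCircle.coe_equivIco_mk_apply 1 u
  rwa [div_one, mul_one] at this

theorem rep_coe_of_mem {u : ℝ} (h0 : 0 ≤ u) (h1 : u < 1) : rep (u : UnitAddCircle) = u := by
  rw [rep_coe, Int.fract_eq_self.2 ⟨h0, h1⟩]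

theorem measurable_rep : Measurable rep :=
  measurable_subtype_coe.comp (AddCircle.measurableEquivIco 1 0).measurable

theorem mul_rep_lt (q : ℕ) [NeZero q] (x : UnitAddCircle) : ⌊q * rep x⌋₊ < q := by
  have hq : (0 : ℝ) < q := by exact_mod_cast NeZero.pos q
  rw [Nat.floor_lt (mul_nonneg hq.le (rep_nonneg x))]
  nlinarith [rep_lt_one x]

/-- The circle as `q` copies of itself, each scaled by `1 / q`. -/
def split (q : ℕ) [NeZero q] : UnitAddCircle ≃ᵐ Fin q × UnitAddCircle where
  toFun x := (⟨⌊q * rep x⌋₊, mul_rep_lt q x⟩, q • x)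
  invFun y := (((y.1 : ℕ) + rep y.2) / q : ℝ)
  left_inv x := by
    have hq : (q : ℝ) ≠ 0 := by exact_mod_cast NeZero.ne q
    have h0 : 0 ≤ q * rep x := mul_nonneg (by positivity) (rep_nonneg x)
    have h1 : rep (q • x) = Int.fract (q * rep x) := by
      rw [← rep_coe, ← nsmul_eq_mul, AddCircle.coe_nsmul, coe_rep]
    simp only [h1]
    rw [Int.fract, ← natCast_floor_eq_intCast_floor h0]
    conv_rhs => rw [← coe_rep x]
    congr 1
    field_simp
    ring
  right_inv y := by
    obtain ⟨i, w⟩ := y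
    have hq : (q : ℝ) ≠ 0 := by exact_mod_cast NeZero.ne q
    have hq0 : (0 : ℝ) < q := by exact_mod_cast NeZero.pos q
    have h0 := rep_nonneg w
    have h1 := rep_lt_one w
    have hi : ((i : ℕ) : ℝ) + 1 ≤ q := by exact_mod_cast i.2
    have h2 : rep (((i : ℕ) + rep w) / q : ℝ) = ((i : ℕ) + rep w) / q := by
      refine rep_coe_of_mem (by positivity) ?_
      rw [div_lt_one hq0]
      linarith
    refine Prod.ext (Fin.ext ?_) ?_
    · simp only [h2]
      rw [mul_div_cancel₀ _ hq, Nat.floor_eq_iff (by positivity)]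
      constructor <;> linarith
    · simp only
      rw [← AddCircle.coe_nsmul, nsmul_eq_mul, mul_div_cancel₀ _ hq, AddCircle.coe_add, coe_rep]
      have : (((i : ℕ) : ℝ) : UnitAddCircle) = 0 := by
        rw [← nsmul_one, AddCircle.coe_nsmul, AddCircle.coe_period, smul_zero]
      rw [this, zero_add]
  measurable_toFun :=
    Measurable.prodMk
      (measurable_to_countable' fun i => by
        have : (fun x => (⟨⌊q * rep x⌋₊, mul_rep_lt q x⟩ : Fin q)) ⁻¹' {i} =
            (fun x => ⌊q * rep x⌋₊) ⁻¹' {(i : ℕ)} := by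
          ext x; simp [Fin.ext_iff]
        rw [this]
        exact (Nat.measurable_floor.comp (measurable_const.mul measurable_rep))
          (measurableSet_singleton _))
      (continuous_nsmul q).measurable
  measurable_invFun := by
    refine AddCircle.measurable_mk'.comp ?_
    have : Measurable fun i : Fin q => ((i : ℕ) : ℝ) := measurable_of_finite _
    exact ((this.comp measurable_fst).add (measurable_rep.comp measurable_snd)).div_const _

variable {q : ℕ} [NeZero q]

theorem split_apply (x : UnitAddCircle) :
    split q x = (⟨⌊q * rep x⌋₊, mul_rep_lt q x⟩, q • x) := rfl

theorem split_symm_apply (i : Fin q) (w : UnitAddCircle) :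
    (split q).symm (i, w) = (((i : ℕ) + rep w) / q : ℝ) := rfl

instance : IsProbabilityMeasure (volume : Measure UnitAddCircle) :=
  ⟨UnitAddCircle.measure_univ⟩

theorem volume_split_preimage_singleton (i : Fin q) {B : Set UnitAddCircle}
    (hB : MeasurableSet B) :
    volume (split q ⁻¹' ({i} ×ˢ B)) = (q : ℝ≥0∞)⁻¹ * volume B := by
  have h0 : ∀ i : Fin q, volume (split q ⁻¹' ({i} ×ˢ B)) =
      volume (split q ⁻¹' ({0} ×ˢ B)) := by
    intro i
    rw [← measure_preimage_add volume (((i : ℕ) / q : ℝ) : UnitAddCircle)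
      (split q ⁻¹' ({i} ×ˢ B))]
    congr 1
    have h1 : ∀ w : UnitAddCircle, (((i : ℕ) / q : ℝ) : UnitAddCircle) + (split q).symm (0, w) =
        (split q).symm (i, w) := by
      intro w
      rw [split_symm_apply, split_symm_apply, ← AddCircle.coe_add]
      congr 1
      simp [add_div]
    ext x
    obtain ⟨⟨j, w⟩, rfl⟩ := (split q).symm.surjective x
    simp only [Set.mem_preimage, MeasurableEquiv.apply_symm_apply, Set.mem_prod,
      Set.mem_singleton_iff]
    constructor
    · rintro ⟨h2, h3⟩
      obtain ⟨w', hw'⟩ : ∃ w', (((i : ℕ) / q : ℝ) : UnitAddCircle) + (split q).symm (j, w) =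
          (split q).symm (i, w') := by
        refine ⟨(split q ((((i : ℕ) / q : ℝ) : UnitAddCircle) + (split q).symm (j, w))).2, ?_⟩
        rw [MeasurableEquiv.eq_symm_apply]
        exact Prod.ext h2 rfl
      rw [← h1, add_left_cancel_iff, (split q).symm.injective.eq_iff, Prod.mk.injEq] at hw'
      refine ⟨hw'.1, ?_⟩
      rw [hw'.1, h1, MeasurableEquiv.apply_symm_apply] at h3
      exact h3
    · rintro ⟨rfl, h3⟩
      rw [h1, MeasurableEquiv.apply_symm_apply]
      exact ⟨rfl, h3⟩
  have h2 : volume B = ∑ j : Fin q, volume (split q ⁻¹' ({j} ×ˢ B)) := by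
    have hmp : MeasurePreserving (fun x : UnitAddCircle => (q : ℤ) • x) volume volume :=
      Measure.measurePreserving_zsmul volume (by exact_mod_cast NeZero.ne q)
    rw [← hmp.measure_preimage hB.nullMeasurableSet, ← measure_biUnion_finset]
    · congr 1
      ext x
      simp [split_apply]
    · intro j _ k _ hjk
      refine Disjoint.preimage _ (Set.disjoint_left.2 ?_)
      rintro ⟨a, b⟩ ⟨ha, -⟩ ⟨hb, -⟩
      exact hjk (ha.symm.trans hb)
    · exact fun j _ => (split q).measurable ((measurableSet_singleton _).prod hB)
  simp only [h0, Finset.sum_const, Finset.card_univ, Fintype.card_fin, nsmul_eq_mul] at h2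
  rw [h0, h2, ← mul_assoc, ENNReal.inv_mul_cancel (by simp [NeZero.ne]) (by simp), one_mul]

theorem measurePreserving_split :
    MeasurePreserving (split q) volume ((unifFin q).prod volume) := by
  refine ⟨(split q).measurable, (Measure.prod_eq fun s t _ ht => ?_).symm⟩
  classical
  rw [(split q).map_apply]
  have hs : s = (s.toFinite.toFinset : Set (Fin q)) := by simp
  have : split q ⁻¹' (s ×ˢ t) = ⋃ i ∈ s.toFinite.toFinset, split q ⁻¹' ({i} ×ˢ t) := by
    ext x; simp
  rw [this, measure_biUnion_finset]
  · simp only [volume_split_preimage_singleton _ ht, Finset.sum_const, nsmul_eq_mul]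
    conv_rhs => rw [hs, unifFin_apply]
    ring
  · intro j _ k _ hjk
    refine Disjoint.preimage _ (Set.disjoint_left.2 ?_)
    rintro ⟨a, b⟩ ⟨ha, -⟩ ⟨hb, -⟩
    exact hjk (ha.symm.trans hb)
  · exact fun j _ => (split q).measurable ((measurableSet_singleton _).prod ht)

theorem measurePreserving_split_symm :
    MeasurePreserving (split q).symm ((unifFin q).prod volume) volume :=
  measurePreserving_split.symm (split q)

/-- Translation by `1 / q` moves each cell to the next one. -/
theorem split_add_inv_of_lt {x : UnitAddCircle} (h : ((split q x).1 : ℕ) + 1 < q) :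
    (((split q (x + (1 / q : ℝ))).1 : Fin q) : ℕ) = (split q x).1 + 1 := by
  have : x + (1 / q : ℝ) = (split q).symm (⟨(split q x).1 + 1, h⟩, (split q x).2) := by
    have hx : x = (split q).symm ((split q x).1, (split q x).2) :=
      ((split q).symm_apply_apply x).symm
    conv_lhs => rw [hx]
    rw [split_symm_apply, split_symm_apply, ← AddCircle.coe_add]
    congr 1
    push_cast
    ring
  rw [this, MeasurableEquiv.apply_symm_apply]

end UnitAddCircle

namespace unitInterval

/-- The quotient map to the circle. -/
def toCircle (z : I) : UnitAddCircle := ((z : ℝ) : UnitAddCircle)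

/-- The section of `toCircle` with values in `[0,1)`. -/
def ofCircle (x : UnitAddCircle) : I := ⟨UnitAddCircle.rep x, UnitAddCircle.rep_nonneg x,
  (UnitAddCircle.rep_lt_one x).le⟩

@[simp]
theorem toCircle_ofCircle (x : UnitAddCircle) : toCircle (ofCircle x) = x :=
  UnitAddCircle.coe_rep x

theorem ae_ne_one : ∀ᵐ z : I, z ≠ 1 := by simp [ae_iff]

theorem rep_toCircle {z : I} (hz : z ≠ 1) : UnitAddCircle.rep (toCircle z) = z :=
  UnitAddCircle.rep_coe_of_mem z.2.1 (lt_of_le_of_ne z.2.2 fun h => hz (Subtype.ext h))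

theorem ofCircle_toCircle : ∀ᵐ z : I, ofCircle (toCircle z) = z := by
  filter_upwards [ae_ne_one] with z hz using Subtype.ext (rep_toCircle hz)

theorem measurePreserving_toCircle : MeasurePreserving toCircle volume volume := by
  have h := UnitAddCircle.measurePreserving_mk 0
  rw [zero_add, restrict_Ioc_eq_restrict_Icc] at h
  exact h.comp measurePreserving_coe

theorem measurable_ofCircle : Measurable ofCircle :=
  UnitAddCircle.measurable_rep.subtype_mk

theorem measurePreserving_ofCircle : MeasurePreserving ofCircle volume volume := by
  refine ⟨measurable_ofCircle, ?_⟩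
  rw [← measurePreserving_toCircle.map_eq,
    Measure.map_map measurable_ofCircle measurePreserving_toCircle.measurable]
  have : ofCircle ∘ toCircle =ᵐ[(volume : Measure I)] id := ofCircle_toCircle
  rw [Measure.map_congr this, Measure.map_id]

/-- The index of the interval `[i / q, (i + 1) / q)` containing a point. -/
def cell (q : ℕ) [NeZero q] (z : I) : Fin q := (UnitAddCircle.split q (toCircle z)).1

variable {q : ℕ} [NeZero q]

theorem measurePreserving_cell : MeasurePreserving (cell q) volume (unifFin q) :=
  measurePreserving_fst.comp
    (UnitAddCircle.measurePreserving_split.comp measurePreserving_toCircle)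

theorem measurable_cell : Measurable (cell q) := measurePreserving_cell.measurable

theorem dist_le_of_cell_eq {z w : I} (hz : z ≠ 1) (hw : w ≠ 1) (h : cell q z = cell q w) :
    dist z w ≤ 1 / q := by
  have hq : (0 : ℝ) < q := by exact_mod_cast NeZero.pos q
  have h' : ⌊q * (z : ℝ)⌋₊ = ⌊q * (w : ℝ)⌋₊ := by
    simpa [cell, UnitAddCircle.split_apply, rep_toCircle hz, rep_toCircle hw] using h
  have h1 := Nat.floor_le (show 0 ≤ q * (z : ℝ) from mul_nonneg hq.le z.2.1)
  have h2 := Nat.floor_le (show 0 ≤ q * (w : ℝ) from mul_nonneg hq.le w.2.1)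
  have h3 := Nat.lt_floor_add_one (q * (z : ℝ))
  have h4 := Nat.lt_floor_add_one (q * (w : ℝ))
  rw [h'] at h1 h3
  rw [Subtype.dist_eq, Real.dist_eq, le_div_iff₀ hq, ← abs_of_pos hq, ← abs_mul, abs_le]
  constructor <;> nlinarith

theorem cell_eq_div (q s : ℕ) [NeZero q] [NeZero (q * s)] (z : I) :
    ((cell q z : Fin q) : ℕ) = (cell (q * s) z : ℕ) / s := by
  have hs : s ≠ 0 := right_ne_zero_of_mul (NeZero.ne (q * s))
  simp only [cell, UnitAddCircle.split_apply]
  rw [← Nat.floor_div_natCast]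
  congr 1
  push_cast
  field_simp

end unitInterval

namespace UnitAddTorus

open UnitAddCircle

variable {d Ω : Type*} [Fintype d] [MeasurableSpace Ω]

/-- Weyl's criterion: convergence of integrals need only be tested on monomials. -/
theorem tendsto_integral_of_forall_mFourier {ν : Measure Ω} [IsFiniteMeasure ν]
    {x : ℕ → Ω → UnitAddTorus d} (hx : ∀ n, Measurable (x n))
    (h : ∀ a : d → ℤ, Tendsto (fun n => ∫ t, mFourier a (x n t) ∂ν) atTop
      (𝓝 (ν.real Set.univ * ∫ y, mFourier a y))) (F : C(UnitAddTorus d, ℂ)) :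
    Tendsto (fun n => ∫ t, F (x n t) ∂ν) atTop (𝓝 (ν.real Set.univ * ∫ y, F y)) := by
  have hi : ∀ (F : C(UnitAddTorus d, ℂ)) n, Integrable (fun t => F (x n t)) ν := fun F n =>
    Integrable.of_bound (F.continuous.measurable.comp (hx n)).aestronglyMeasurable ‖F‖
      (Eventually.of_forall fun t => F.norm_coe_le_norm _)
  have hj : ∀ F : C(UnitAddTorus d, ℂ), Integrable (fun y => F y) := fun F =>
    Integrable.of_bound F.continuous.measurable.aestronglyMeasurable ‖F‖
      (Eventually.of_forall fun t => F.norm_coe_le_norm _)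
  let S : Submodule ℂ C(UnitAddTorus d, ℂ) :=
    { carrier := {F | Tendsto (fun n => ∫ t, F (x n t) ∂ν) atTop
        (𝓝 (ν.real Set.univ * ∫ y, F y))}
      zero_mem' := by simp
      add_mem' := fun {F G} hF hG => by
        have := Tendsto.add hF hG
        rw [← mul_add, ← integral_add (hj F) (hj G)] at this
        refine this.congr fun n => ?_
        rw [← integral_add (hi F n) (hi G n)]
        rfl
      smul_mem' := fun c F hF => by
        have := Tendsto.const_mul c hF
        rw [mul_left_comm, ← integral_const_mul] at this
        refine this.congr fun n => ?_
        rw [← integral_const_mul]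
        rfl }
  have hS : IsClosed (S : Set C(UnitAddTorus d, ℂ)) := by
    refine isClosed_of_closure_subset fun F hF => ?_
    change Tendsto _ _ _
    rw [Metric.tendsto_atTop]
    intro ε hε
    have hc : 0 ≤ ν.real Set.univ := measureReal_nonneg
    obtain ⟨G, hG, hFG⟩ := Metric.mem_closure_iff.1 hF (ε / (3 * (ν.real Set.univ + 1)))
      (by positivity)
    have hcε : ν.real Set.univ * ‖F - G‖ ≤ ε / 3 := by
      rw [dist_eq_norm, lt_div_iff₀ (by positivity)] at hFG
      nlinarith [norm_nonneg (F - G)]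
    obtain ⟨n₀, hn₀⟩ := Metric.tendsto_atTop.1 (show Tendsto _ _ _ from hG) (ε / 3)
      (by positivity)
    refine ⟨n₀, fun n hn => ?_⟩
    have h1 : dist (∫ t, F (x n t) ∂ν) (∫ t, G (x n t) ∂ν) ≤ ε / 3 := by
      rw [dist_eq_norm, ← integral_sub (hi F n) (hi G n)]
      refine (norm_integral_le_of_norm_le_const (C := ‖F - G‖)
        (Eventually.of_forall fun t => (F - G).norm_coe_le_norm _)).trans ?_
      rwa [mul_comm]
    have h2 : dist (ν.real Set.univ * ∫ y, G y : ℂ) (ν.real Set.univ * ∫ y, F y) ≤ ε / 3 := by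
      rw [dist_comm, dist_eq_norm, ← mul_sub, ← integral_sub (hj F) (hj G), norm_mul,
        Complex.norm_real, Real.norm_of_nonneg hc]
      refine (mul_le_mul_of_nonneg_left (norm_integral_le_of_norm_le_const (C := ‖F - G‖)
        (Eventually.of_forall fun t => (F - G).norm_coe_le_norm _)) hc).trans ?_
      simpa using hcε
    have h3 := hn₀ n hn
    have h4 := dist_triangle4 (∫ t, F (x n t) ∂ν) (∫ t, G (x n t) ∂ν)
      (ν.real Set.univ * ∫ y, G y : ℂ) (ν.real Set.univ * ∫ y, F y)
    linarith
  have hle : (Submodule.span ℂ (Set.range (mFourier (d := d)))).topologicalClosure ≤ S :=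
    Submodule.topologicalClosure_minimal _ (Submodule.span_le.2 (by
      rintro _ ⟨a, rfl⟩
      exact h a)) hS
  rw [span_mFourier_closure_eq_top] at hle
  exact hle (Submodule.mem_top (x := F))

theorem intervalIntegral_fourier {m : ℤ} (hm : m ≠ 0) (β γ : ℝ) :
    ∫ α in β..γ, fourier m (α : UnitAddCircle) =
      (Complex.exp (2 * Real.pi * Complex.I * m * γ) -
        Complex.exp (2 * Real.pi * Complex.I * m * β)) / (2 * Real.pi * Complex.I * m) := by
  have hc : 2 * Real.pi * Complex.I * m ≠ 0 :=
    mul_ne_zero Complex.two_pi_I_ne_zero (Int.cast_ne_zero.2 hm)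
  rw [← integral_exp_mul_complex hc]
  refine intervalIntegral.integral_congr fun α _ => ?_
  simp only [fourier_coe_apply, Complex.ofReal_one, div_one]

theorem norm_intervalIntegral_fourier_le {m : ℤ} (hm : m ≠ 0) (β γ : ℝ) :
    ‖∫ α in β..γ, fourier m (α : UnitAddCircle)‖ ≤ |(m : ℝ)|⁻¹ := by
  have h1 : ∀ t : ℝ, ‖Complex.exp (2 * Real.pi * Complex.I * m * t)‖ = 1 := by
    intro t
    rw [show 2 * Real.pi * Complex.I * m * t = ((2 * Real.pi * m * t : ℝ) : ℂ) * Complex.I by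
      push_cast; ring, Complex.norm_exp_ofReal_mul_I]
  have hm' : 0 < |(m : ℝ)| := abs_pos.2 (Int.cast_ne_zero.2 hm)
  have h2 : ‖(2 * Real.pi * Complex.I * m : ℂ)‖ = 2 * Real.pi * |(m : ℝ)| := by
    simp [abs_of_pos Real.pi_pos]
  rw [intervalIntegral_fourier hm, norm_div, h2, div_le_iff₀ (by positivity)]
  refine (norm_sub_le _ _).trans ?_
  rw [h1, h1, mul_left_comm, inv_mul_cancel₀ hm'.ne', mul_one]
  linarith [Real.two_le_pi]

theorem integral_fourier {m : ℤ} (hm : m ≠ 0) : ∫ x : UnitAddCircle, fourier m x = 0 := by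
  rw [← AddCircle.intervalIntegral_preimage 1 0, intervalIntegral_fourier hm, zero_add]
  have : Complex.exp (2 * Real.pi * Complex.I * m * (1 : ℝ)) = 1 := by
    rw [Complex.exp_eq_one_iff]
    exact ⟨m, by push_cast; ring⟩
  rw [this]
  simp

theorem integral_mFourier {a : d → ℤ} (ha : a ≠ 0) :
    ∫ y : UnitAddTorus d, mFourier a y = 0 := by
  obtain ⟨j, hj⟩ := Function.ne_iff.1 ha
  refine (integral_fintype_prod_volume_eq_prod (fun i (x : UnitAddCircle) =>
    (fourier (a i) x : ℂ))).trans ?_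
  exact Finset.prod_eq_zero (Finset.mem_univ j) (integral_fourier hj)

theorem mFourier_zsmul (a m : d → ℤ) (x : UnitAddCircle) :
    mFourier a (fun j => m j • x) = fourier (∑ j, a j * m j) x := by
  have : ∀ s : Finset d, ∏ j ∈ s, (fourier (a j) (m j • x) : ℂ) =
      fourier (∑ j ∈ s, a j * m j) x := by
    classical
    intro s
    induction s using Finset.induction_on with
    | empty => simp
    | insert j s hj ih =>
      have h : (fourier (a j) (m j • x) : ℂ) = fourier (a j * m j) x := by
        rw [fourier_apply, fourier_apply, smul_smul]
      rw [Finset.prod_insert hj, Finset.sum_insert hj, fourier_add, ih, h]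
  exact this Finset.univ

variable {φ : d → ℕ → ℤ}

/-- Asymptotically independent sequences of multiples of a point of a fixed interval become
equidistributed. -/
theorem tendsto_intervalIntegral_zsmul
    (hφ : ∀ a : d → ℤ, a ≠ 0 → Tendsto (fun n => |∑ j, a j * φ j n|) atTop atTop)
    {β γ : ℝ} (hβγ : β ≤ γ) (F : C(UnitAddTorus d, ℂ)) :
    Tendsto (fun n => ∫ α in β..γ, F fun j => φ j n • (α : UnitAddCircle)) atTop
      (𝓝 ((γ - β : ℝ) * ∫ y, F y)) := by
  have hreal : (volume.restrict (Set.Ioc β γ)).real Set.univ = γ - β := by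
    simp [hβγ]
  simp only [intervalIntegral.integral_of_le hβγ]
  rw [← hreal]
  refine tendsto_integral_of_forall_mFourier
    (x := fun n (α : ℝ) j => φ j n • (α : UnitAddCircle)) (fun n => ?_) (fun a => ?_) F
  · exact measurable_pi_lambda _ fun j =>
      (continuous_zsmul (φ j n)).measurable.comp AddCircle.measurable_mk'
  simp only [mFourier_zsmul]
  rcases eq_or_ne a 0 with rfl | ha
  · simp [mFourier_zero]
  rw [integral_mFourier ha, mul_zero]
  simp only [← intervalIntegral.integral_of_le hβγ]
  have h1 : Tendsto (fun n => |((∑ j, a j * φ j n : ℤ) : ℝ)|⁻¹) atTop (𝓝 0) := by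
    refine tendsto_inv_atTop_zero.comp ?_
    have := tendsto_intCast_atTop_atTop (R := ℝ) |>.comp (hφ a ha)
    refine this.congr fun n => ?_
    simp only [Function.comp_apply, Int.cast_abs]
  refine squeeze_zero_norm' ?_ h1
  filter_upwards [(hφ a ha).eventually_gt_atTop 0] with n hn
  exact norm_intervalIntegral_fourier_le (abs_pos.1 hn) β γ

/-- An asymptotic Kronecker theorem. -/
theorem eventually_exists_forall_dist_zsmul_lt
    (hφ : ∀ a : d → ℤ, a ≠ 0 → Tendsto (fun n => |∑ j, a j * φ j n|) atTop atTop)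
    {β γ : ℝ} (hβγ : β < γ) (θ : UnitAddTorus d) {η : ℝ} (hη : 0 < η) :
    ∀ᶠ n in atTop, ∃ α ∈ Set.Icc β γ, ∀ j, dist (φ j n • (α : UnitAddCircle)) (θ j) < η := by
  let g : UnitAddTorus d → ℝ := fun y => max 0 (η - dist y θ)
  have hg : Continuous g := by fun_prop
  have hpos : 0 < ∫ y, g y := by
    refine hg.integral_pos_of_hasCompactSupport_nonneg_nonzero (x := θ)
      (HasCompactSupport.of_compactSpace g) (fun y => le_max_left _ _) ?_
    simp [g, hη.le, hη.ne']
  let F : C(UnitAddTorus d, ℂ) := ⟨fun y => (g y : ℂ), Complex.continuous_ofReal.comp hg⟩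
  have hF : ((γ - β : ℝ) * ∫ y, F y : ℂ) ≠ 0 := by
    have : ∫ y, F y = ((∫ y, g y : ℝ) : ℂ) := integral_ofReal
    rw [this, ← Complex.ofReal_mul]
    exact Complex.ofReal_ne_zero.2 (mul_pos (sub_pos.2 hβγ) hpos).ne'
  filter_upwards [(tendsto_intervalIntegral_zsmul hφ hβγ.le F).eventually_ne hF] with n hn
  by_contra! hcon
  refine hn ?_
  rw [intervalIntegral.integral_congr (g := fun _ => 0), intervalIntegral.integral_zero]
  intro α hα
  rw [Set.uIcc_of_le hβγ.le] at hα
  obtain ⟨j, hj⟩ := hcon α hα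
  have : η ≤ dist (fun j => φ j n • (α : UnitAddCircle)) θ :=
    hj.trans (dist_le_pi_dist (fun j => φ j n • (α : UnitAddCircle)) θ j)
  simp [F, g, this]

end UnitAddTorus

theorem integral_unifFin {q : ℕ} (f : Fin q → ℝ) :
    ∫ i, f i ∂(unifFin q) = (q : ℝ)⁻¹ * ∑ i, f i := by
  rw [unifFin, integral_smul_measure, integral_count]
  simp

theorem measureReal_unifFin {q : ℕ} (s : Finset (Fin q)) :
    (unifFin q).real s = (q : ℝ)⁻¹ * s.card := by
  rw [measureReal_def, unifFin_apply]
  simp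

/-- Riemann sums of a continuous function converge to its integral. -/
theorem tendsto_riemannSum {f : ℝ → ℝ} (hf : Continuous f) :
    Tendsto (fun n : ℕ => ((n + 1 : ℕ) : ℝ)⁻¹ * ∑ r : Fin (n + 1), f ((r : ℕ) / ((n + 1 : ℕ) : ℝ)))
      atTop (𝓝 (∫ x in (0 : ℝ)..1, f x)) := by
  have h1 : ∫ x in (0 : ℝ)..1, f x = ∫ z : I, f z := by
    rw [intervalIntegral.integral_of_le zero_le_one, ← integral_Icc_eq_integral_Ioc]
    exact integral_subtype_comap measurableSet_Icc f |>.symm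
  rw [h1]
  obtain ⟨C, hC⟩ := isCompact_Icc.exists_bound_of_continuousOn (hf.continuousOn (s := I))
  have hmem : ∀ (n : ℕ) (r : Fin (n + 1)), ((r : ℕ) / ((n + 1 : ℕ) : ℝ)) ∈ I := fun n r => by
    refine ⟨by positivity, div_le_one_of_le₀ ?_ (by positivity)⟩
    exact_mod_cast r.2.le
  have h2 : ∀ n : ℕ,
      ((n + 1 : ℕ) : ℝ)⁻¹ * ∑ r : Fin (n + 1), f ((r : ℕ) / ((n + 1 : ℕ) : ℝ)) =
      ∫ z : I, f ((unitInterval.cell (n + 1) z : ℕ) / ((n + 1 : ℕ) : ℝ)) := fun n => by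
    rw [← integral_unifFin fun r : Fin (n + 1) => f ((r : ℕ) / ((n + 1 : ℕ) : ℝ)),
      ← (unitInterval.measurePreserving_cell (q := n + 1)).map_eq,
      integral_map unitInterval.measurable_cell.aemeasurable
        (measurable_of_finite _).aestronglyMeasurable]
  simp only [h2]
  refine tendsto_integral_of_dominated_convergence (fun _ => C) (fun n => ?_)
    (integrable_const C) (fun n => ae_of_all _ fun z => hC _ (hmem n _)) ?_
  · exact ((measurable_of_finite (fun r : Fin (n + 1) =>
      f ((r : ℕ) / ((n + 1 : ℕ) : ℝ)))).comp unitInterval.measurable_cell).aestronglyMeasurable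
  · filter_upwards [unitInterval.ae_ne_one] with z hz
    refine (hf.tendsto _).comp ?_
    have h3 := tendsto_nat_floor_mul_div_atTop (R := ℝ) z.2.1
    have h4 := h3.comp (tendsto_natCast_atTop_atTop.comp (tendsto_add_atTop_nat 1))
    refine h4.congr fun n => ?_
    simp only [Function.comp_apply, unitInterval.cell, UnitAddCircle.split_apply,
      unitInterval.rep_toCircle hz, mul_comm]

/-- Averages of values of continuous functions on the circle approximate the mixtures of the
value at `0` and the mean, with weights prescribed in advance. -/
theorem UnitAddCircle.exists_average_sub_lt {ι κ : Type*} [Finite ι] [Finite κ] {lam : κ → ℝ}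
    (hlam : ∀ j, lam j ∈ Set.Icc (0 : ℝ) 1) {g : ι → UnitAddCircle → ℝ}
    (hg : ∀ i, Continuous (g i)) {ε : ℝ} (hε : 0 < ε) :
    ∃ R : ℕ, 0 < R ∧ ∃ θ : Fin R → κ → UnitAddCircle, ∀ i j,
      |(R : ℝ)⁻¹ * ∑ r, g i (θ r j) - ((1 - lam j) * g i 0 + lam j * ∫ x, g i x)| < ε := by
  have key : ∀ j, ∃ h : ℝ → UnitAddCircle, Continuous h ∧ ∀ i,
      ∫ x in (0 : ℝ)..1, g i (h x) = (1 - lam j) * g i 0 + lam j * ∫ x, g i x := by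
    intro j
    rcases (hlam j).1.eq_or_lt with h0 | h0
    · exact ⟨fun _ => 0, continuous_const, fun i => by simp [← h0]⟩
    have hc : Continuous fun x : ℝ => ((min (x / lam j) 1 : ℝ) : UnitAddCircle) :=
      (AddCircle.continuous_mk' 1).comp (by fun_prop)
    refine ⟨fun x => ((min (x / lam j) 1 : ℝ) : UnitAddCircle), hc, fun i => ?_⟩
    have hint : ∀ a b : ℝ, IntervalIntegrable
        (fun x : ℝ => g i ((min (x / lam j) 1 : ℝ) : UnitAddCircle)) volume a b :=
      fun a b => ((hg i).comp hc).intervalIntegrable a b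
    rw [← intervalIntegral.integral_add_adjacent_intervals (hint 0 (lam j)) (hint (lam j) 1)]
    have h1 : ∫ x in (0 : ℝ)..lam j, g i ((min (x / lam j) 1 : ℝ) : UnitAddCircle) =
        ∫ x in (0 : ℝ)..lam j, g i ((x / lam j : ℝ) : UnitAddCircle) := by
      refine intervalIntegral.integral_congr fun x hx => ?_
      rw [Set.uIcc_of_le h0.le] at hx
      simp only [min_eq_left (div_le_one_of_le₀ hx.2 h0.le)]
    have h2 : ∫ x in lam j..1, g i ((min (x / lam j) 1 : ℝ) : UnitAddCircle) =
        ∫ x in lam j..1, g i 0 := by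
      refine intervalIntegral.integral_congr fun x hx => ?_
      rw [Set.uIcc_of_le (hlam j).2] at hx
      simp only [min_eq_right ((one_le_div h0).2 hx.1), AddCircle.coe_period]
    rw [h1, h2, intervalIntegral.integral_const,
      intervalIntegral.integral_comp_div (fun x : ℝ => g i (x : UnitAddCircle)) h0.ne', zero_div,
      div_self h0.ne', ← UnitAddCircle.intervalIntegral_preimage 0 (g i), zero_add]
    simp only [smul_eq_mul]
    ring
  choose h hhc hh using key
  have : ∀ᶠ n : ℕ in atTop, ∀ i j,
      |((n + 1 : ℕ) : ℝ)⁻¹ * ∑ r : Fin (n + 1), g i (h j ((r : ℕ) / ((n + 1 : ℕ) : ℝ))) -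
        ((1 - lam j) * g i 0 + lam j * ∫ x, g i x)| < ε := by
    refine eventually_all.2 fun i => eventually_all.2 fun j => ?_
    rw [← hh]
    exact (tendsto_riemannSum ((hg i).comp (hhc j))).eventually (Metric.ball_mem_nhds _ hε)
  obtain ⟨n, hn⟩ := this.exists
  exact ⟨n + 1, n.succ_pos, fun r j => h j ((r : ℕ) / ((n + 1 : ℕ) : ℝ)), hn⟩

/-- A measure-preserving action of `ℤ` on a space isomorphic to `[0,1]` comes from an element of
`Aut01`. -/
theorem Aut01.exists_forall_zpow_ae_eq {Y : Type*} [MeasurableSpace Y] {ν : Measure Y} {P : I → Y}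
    {P' : Y → I} (hP : MeasurePreserving P volume ν) (hP' : MeasurePreserving P' ν volume)
    (h1 : ∀ y, P (P' y) = y) (h2 : ∀ᵐ z, P' (P z) = z) {F : ℤ → Y → Y}
    (hF : ∀ m, MeasurePreserving (F m) ν ν) (h0 : ∀ y, F 0 y = y)
    (hadd : ∀ m n y, F (m + n) y = F m (F n y)) :
    ∃ T : Aut01, ∀ m : ℤ, ∀ᵐ z, P ((T.toEquiv ^ m : Equiv.Perm I) z) = F m (P z) := by
  have hinv : ∀ m n, m + n = 0 → ∀ᵐ z, P' (F m (P (P' (F n (P z))))) = z := by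
    intro m n hmn
    filter_upwards [h2] with z hz
    rw [h1, ← hadd, hmn, h0, hz]
  obtain ⟨T, hT, hT'⟩ := Aut01.exists_ae_eq (hP'.comp ((hF 1).comp hP))
    (hP'.comp ((hF (-1)).comp hP)) (hinv (-1) 1 (by norm_num)) (hinv 1 (-1) (by norm_num))
  refine ⟨T, fun m => ?_⟩
  induction m using Int.induction_on with
  | zero => exact ae_of_all _ fun z => (h0 _).symm
  | succ k ih =>
    filter_upwards [T.measurePreserving_toFun.quasiMeasurePreserving.ae ih, hT] with z hz hz'
    have : P (T.toEquiv z) = F 1 (P z) := by rw [hz']; exact h1 _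
    rw [zpow_add, zpow_one, Equiv.Perm.mul_apply, hz, this, ← hadd]
  | pred k ih =>
    filter_upwards [T.measurePreserving_invFun.quasiMeasurePreserving.ae ih, hT'] with z hz hz'
    have : P (T.toEquiv.symm z) = F (-1) (P z) := by rw [hz']; exact h1 _
    rw [sub_eq_add_neg, zpow_add, zpow_neg_one, Equiv.Perm.mul_apply]
    refine hz.trans ?_
    rw [this, ← hadd]

theorem measureReal_unifFin_prod {R : ℕ} [NeZero R] {X : Type*} [MeasurableSpace X] {μ : Measure X}
    [IsFiniteMeasure μ] {S : Set (Fin R × X)} (hS : MeasurableSet S) :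
    ((unifFin R).prod μ).real S = (R : ℝ)⁻¹ * ∑ r, μ.real {x | (r, x) ∈ S} := by
  rw [measureReal_def, Measure.prod_apply hS, lintegral_unifFin, ENNReal.toReal_mul,
    ENNReal.toReal_sum fun r _ => measure_ne_top _ _]
  simp [measureReal_def, Set.preimage]

namespace UnitAddCircle

variable {K : Type*} [Finite K] [MeasurableSpace K] [MeasurableSingletonClass K]
  {κ : UnitAddCircle → K}

theorem measurableSet_pair (hκ : Measurable κ) (S : Set (K × K)) (s : UnitAddCircle) :
    MeasurableSet {x | (κ x, κ (x + s)) ∈ S} :=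
  (hκ.prodMk (hκ.comp (measurable_add_const s))) S.toFinite.measurableSet

theorem tendsto_volume_ne_add (hκ : Measurable κ) :
    Tendsto (fun s : UnitAddCircle => volume.real {x | κ (x + s) ≠ κ x}) (𝓝 0) (𝓝 0) := by
  have := Fintype.ofFinite K
  have h1 : ∀ a : K, Tendsto (fun s : UnitAddCircle =>
      volume.real (symmDiff ((fun x => x + s) ⁻¹' (κ ⁻¹' {a})) (κ ⁻¹' {a}))) (𝓝 0) (𝓝 0) := by
    intro a
    let f : UnitAddCircle → C(UnitAddCircle, UnitAddCircle) := fun s => ⟨fun x => x + s, by fun_prop⟩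
    have hf : Continuous f := ContinuousMap.continuous_of_continuous_uncurry _ (by
      simp only [f, Function.uncurry_def, ContinuousMap.coe_mk]; fun_prop)
    have h2 := tendsto_measure_symmDiff_preimage_nhds_zero (μ := volume) (ν := volume)
      (hf.tendsto 0) (Eventually.of_forall fun s => measurePreserving_add_right volume s)
      (measurePreserving_add_right volume 0)
      (hκ (measurableSet_singleton a)).nullMeasurableSet (measure_ne_top _ _)
    have h3 := (ENNReal.tendsto_toReal ENNReal.zero_ne_top).comp h2
    simpa [f, Function.comp_def, measureReal_def] using h3
  have h4 := tendsto_finsetSum Finset.univ fun a _ => h1 a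
  rw [Finset.sum_const_zero] at h4
  refine squeeze_zero (fun _ => measureReal_nonneg) (fun s => ?_) h4
  refine (measureReal_mono ?_).trans (measureReal_iUnion_fintype_le _)
  intro x hx
  exact Set.mem_iUnion.2 ⟨κ x, Or.inr ⟨rfl, hx⟩⟩

/-- Correlations of a finite partition under translations are continuous. -/
theorem continuous_volume_pair (hκ : Measurable κ) (S : Set (K × K)) :
    Continuous fun s : UnitAddCircle => volume.real {x | (κ x, κ (x + s)) ∈ S} := by
  refine continuous_iff_continuousAt.2 fun s₀ => ?_
  rw [ContinuousAt, tendsto_iff_dist_tendsto_zero]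
  have h1 : Tendsto (fun s : UnitAddCircle => s - s₀) (𝓝 s₀) (𝓝 0) := by
    have : Continuous fun s : UnitAddCircle => s - s₀ := by fun_prop
    simpa using this.tendsto s₀
  refine squeeze_zero (fun _ => dist_nonneg) (fun s => ?_) ((tendsto_volume_ne_add hκ).comp h1)
  have h2 : volume.real {x | κ (x + s) ≠ κ (x + s₀)} =
      volume.real {x | κ (x + (s - s₀)) ≠ κ x} := by
    rw [← (measurePreserving_add_right volume s₀).measureReal_preimage
      (s := {x | κ (x + (s - s₀)) ≠ κ x})
      (measurableSet_pair hκ {p | p.2 ≠ p.1} _).nullMeasurableSet]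
    congr 1
    ext x
    simp [add_assoc]
  rw [Function.comp_apply, ← h2, Real.dist_eq]
  have h3 : MeasurableSet {x | κ (x + s) ≠ κ (x + s₀)} :=
    ((hκ.comp (measurable_add_const s)).prodMk (hκ.comp (measurable_add_const s₀)))
      (Set.toFinite {p : K × K | p.1 ≠ p.2}).measurableSet
  have key : ∀ s t : UnitAddCircle, volume.real {x | (κ x, κ (x + s)) ∈ S} ≤
      volume.real {x | (κ x, κ (x + t)) ∈ S} + volume.real {x | κ (x + s) ≠ κ (x + t)} := by
    intro s t
    refine (measureReal_mono fun x hx => ?_).trans (measureReal_union_le _ _)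
    by_cases h : κ (x + s) = κ (x + t)
    · left
      simpa only [Set.mem_ofPred_eq, h] using hx
    · exact Or.inr h
  rw [abs_sub_le_iff]
  have h4 := key s s₀
  have h5 := key s₀ s
  simp only [ne_comm (a := κ (_ + s₀))] at h5
  constructor <;> linarith

theorem integral_volume_pair (hκ : Measurable κ) (A B : Set K) :
    ∫ s, volume.real {x | (κ x, κ (x + s)) ∈ A ×ˢ B} =
      volume.real (κ ⁻¹' A) * volume.real (κ ⁻¹' B) := by
  have hA : MeasurableSet (κ ⁻¹' A) := hκ A.toFinite.measurableSet
  have hB : MeasurableSet (κ ⁻¹' B) := hκ B.toFinite.measurableSet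
  have hmp := measurePreserving_prod_add (volume : Measure UnitAddCircle)
    (volume : Measure UnitAddCircle)
  have h1 := hmp.measure_preimage (hA.prod hB).nullMeasurableSet
  rw [Measure.prod_apply_symm (hmp.measurable (hA.prod hB)), Measure.prod_prod] at h1
  have h2 := congrArg ENNReal.toReal h1
  rw [ENNReal.toReal_mul] at h2
  refine Eq.trans ?_ h2
  exact integral_toReal (measurable_measure_prodMk_right
    (hmp.measurable (hA.prod hB))).aemeasurable (ae_of_all _ fun _ => measure_lt_top _ _)


/-- The permutation of `Fin (q * M)` acting on the `t`-th level of the `i`-th tower as the `t`-th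
power of `π` on indices of towers. -/
def towerPerm {q : ℕ} (M : ℕ) (π : Equiv.Perm (Fin q)) : Equiv.Perm (Fin (q * M)) :=
  finProdFinEquiv.permCongr
    { toFun := fun p => ((π ^ (p.2 : ℕ)) p.1, p.2)
      invFun := fun p => ((π ^ (p.2 : ℕ)).symm p.1, p.2)
      left_inv := fun p => by simp
      right_inv := fun p => by simp }

variable {q M : ℕ} [NeZero (q * M)]

/-- The colouring of the circle which is cyclically permuted by the translation by `1 / (q * M)`
according to `π`, up to a set of measure at most `1 / M`. -/
def towerColour (M : ℕ) [NeZero (q * M)] (π : Equiv.Perm (Fin q)) (x : UnitAddCircle) : Fin q :=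
  (finProdFinEquiv.symm (towerPerm M π (split (q * M) x).1)).1

theorem measurable_towerColour (π : Equiv.Perm (Fin q)) : Measurable (towerColour M π) :=
  (measurable_of_finite fun s : Fin (q * M) => (finProdFinEquiv.symm (towerPerm M π s)).1).comp
    (measurable_fst.comp (split (q * M)).measurable)

theorem towerColour_eq (π : Equiv.Perm (Fin q)) (x : UnitAddCircle) :
    towerColour M π x = (π ^ ((split (q * M) x).1.modNat : ℕ)) (split (q * M) x).1.divNat := by
  simp [towerColour, towerPerm, finProdFinEquiv_symm_apply]

theorem volume_towerColour_add_inv_ne_le (π : Equiv.Perm (Fin q)) :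
    volume.real {x | towerColour M π (x + (1 / (q * M : ℕ) : ℝ)) ≠ π (towerColour M π x)} ≤
      1 / M := by
  have hM : M ≠ 0 := right_ne_zero_of_mul (NeZero.ne (q * M))
  have hq0 : q ≠ 0 := left_ne_zero_of_mul (NeZero.ne (q * M))
  let s : Finset (Fin (q * M)) := (Finset.univ : Finset (Fin q)).image
    fun i => finProdFinEquiv (i, ⟨M - 1, by omega⟩)
  have h1 : {x | towerColour M π (x + (1 / (q * M : ℕ) : ℝ)) ≠ π (towerColour M π x)} ⊆
      (fun x => (split (q * M) x).1) ⁻¹' s := by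
    intro x hx
    by_contra hxs
    apply hx
    have h2 : ((split (q * M) x).1.modNat : ℕ) + 1 < M := by
      refine lt_of_le_of_ne (split (q * M) x).1.modNat.2 fun h => hxs ?_
      simp only [Set.mem_preimage, s, Finset.coe_image, Finset.coe_univ, Set.image_univ]
      refine ⟨(split (q * M) x).1.divNat, ?_⟩
      rw [← Equiv.eq_symm_apply, finProdFinEquiv_symm_apply]
      exact Prod.ext rfl (Fin.ext (by simp only; omega))
    have h3 : ((split (q * M) x).1 : ℕ) + 1 < q * M := by
      have h4 := (split (q * M) x).1.divNat.2
      have h5 := Nat.div_add_mod ((split (q * M) x).1 : ℕ) M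
      simp only [Fin.coe_divNat, Fin.coe_modNat] at h2 h4
      have h6 := Nat.mul_le_mul_left M (Nat.succ_le_of_lt h4)
      rw [Nat.mul_succ, mul_comm M q] at h6
      omega
    have h4 := split_add_inv_of_lt h3
    have h7 : (((split (q * M) x).1 : ℕ) + 1) / M = ((split (q * M) x).1 : ℕ) / M ∧
        (((split (q * M) x).1 : ℕ) + 1) % M = ((split (q * M) x).1 : ℕ) % M + 1 := by
      rw [Fin.coe_modNat] at h2
      have := Nat.mod_add_div ((split (q * M) x).1 : ℕ) M
      exact (Nat.div_mod_unique (Nat.pos_of_ne_zero hM)).2 ⟨by omega, h2⟩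
    have h5 : ((split (q * M) (x + (1 / (q * M : ℕ) : ℝ))).1.modNat : ℕ) =
        (split (q * M) x).1.modNat + 1 := by
      rw [Fin.coe_modNat, h4, Fin.coe_modNat, h7.2]
    have h6 : (split (q * M) (x + (1 / (q * M : ℕ) : ℝ))).1.divNat =
        (split (q * M) x).1.divNat := Fin.ext (by rw [Fin.coe_divNat, h4, Fin.coe_divNat, h7.1])
    rw [towerColour_eq, towerColour_eq, h5, h6, pow_succ', Equiv.Perm.mul_apply]
  refine (measureReal_mono h1).trans ?_
  have hmp : MeasurePreserving (fun x => (split (q * M) x).1) volume (unifFin (q * M)) :=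
    measurePreserving_fst.comp measurePreserving_split
  rw [hmp.measureReal_preimage s.measurableSet.nullMeasurableSet, measureReal_unifFin]
  have hc : s.card ≤ q := Finset.card_image_le.trans_eq (by simp)
  have hq : (q : ℝ) ≠ 0 := by exact_mod_cast hq0
  have hM' : (M : ℝ) ≠ 0 := by exact_mod_cast hM
  calc ((q * M : ℕ) : ℝ)⁻¹ * s.card ≤ ((q * M : ℕ) : ℝ)⁻¹ * q := by gcongr
    _ = 1 / M := by push_cast; field_simp

/-- The circle as a union of `R` circles of equal length, with levels relabelled so that
`towerColour` is a colouring by intervals on each of them. -/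
theorem exists_measurableEquiv_towerColour [NeZero q] (R : ℕ) [NeZero R] (π : Equiv.Perm (Fin q)) :
    ∃ e : UnitAddCircle ≃ᵐ Fin R × UnitAddCircle,
      MeasurePreserving e volume ((unifFin R).prod volume) ∧
      ∀ x, (towerColour M π (e x).2 : ℕ) = ((split (q * M) x).1 : ℕ) / M := by
  let p : Fin (q * M) ≃ᵐ Fin (q * M) :=
    { toEquiv := (towerPerm M π).symm
      measurable_toFun := measurable_of_finite _
      measurable_invFun := measurable_of_finite _ }
  have hp : MeasurePreserving p (unifFin (q * M)) (unifFin (q * M)) :=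
    measurePreserving_perm_unifFin _
  let e₁ := (split (q * M)).trans (p.prodCongr (split R))
  have h₁ : MeasurePreserving e₁ volume ((unifFin (q * M)).prod ((unifFin R).prod volume)) :=
    (hp.prod measurePreserving_split).comp measurePreserving_split
  let e₂ := (e₁.trans MeasurableEquiv.prodComm).trans MeasurableEquiv.prodAssoc
  have h₂ : MeasurePreserving e₂ volume
      ((unifFin R).prod ((volume : Measure UnitAddCircle).prod (unifFin (q * M)))) :=
    (measurePreserving_prodAssoc _ _ _).comp (Measure.measurePreserving_swap.comp h₁)
  let e₃ := e₂.trans ((MeasurableEquiv.refl (Fin R)).prodCongr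
    (MeasurableEquiv.prodComm.trans (split (q * M)).symm))
  have h₃ : MeasurePreserving e₃ volume ((unifFin R).prod volume) :=
    ((MeasurePreserving.id (unifFin R)).prod
      (measurePreserving_split_symm.comp Measure.measurePreserving_swap)).comp h₂
  refine ⟨e₃, h₃, fun x => ?_⟩
  have : (split (q * M) (e₃ x).2).1 = (towerPerm M π).symm (split (q * M) x).1 := by
    simp only [e₃, e₂, e₁]
    exact congrArg Prod.fst ((split (q * M)).apply_symm_apply _)
  rw [towerColour, this, Equiv.apply_symm_apply, finProdFinEquiv_symm_apply]
  rfl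

end UnitAddCircle

namespace Aut01

open unitInterval UnitAddCircle

/-- Rotations by different angles on `R` copies of the circle, coloured by `towerColour`, as a
transformation of `[0,1]` coloured by `cell`. -/
theorem exists_forall_volume_cell_pair {q M R : ℕ} [NeZero q] [NeZero (q * M)] [NeZero R]
    (π : Equiv.Perm (Fin q)) (α : Fin R → UnitAddCircle) :
    ∃ T : Aut01, ∀ (m : ℤ) (S : Set (Fin q × Fin q)),
      volume.real {z | (cell q z, cell q ((T.toEquiv ^ m : Equiv.Perm I) z)) ∈ S} =
        (R : ℝ)⁻¹ * ∑ r, volume.real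
          {x | (towerColour M π x, towerColour M π (x + m • α r)) ∈ S} := by
  obtain ⟨e, he, hcol⟩ := exists_measurableEquiv_towerColour (M := M) R π
  have hP : MeasurePreserving (e ∘ toCircle) volume ((unifFin R).prod volume) :=
    he.comp measurePreserving_toCircle
  have hP' : MeasurePreserving (ofCircle ∘ e.symm) ((unifFin R).prod volume) volume :=
    measurePreserving_ofCircle.comp (he.symm e)
  let F : ℤ → Fin R × UnitAddCircle → Fin R × UnitAddCircle := fun m y => (y.1, y.2 + m • α y.1)
  have hF : ∀ m, MeasurePreserving (F m) ((unifFin R).prod volume) ((unifFin R).prod volume) := by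
    intro m
    refine (MeasurePreserving.id (unifFin R)).skew_product (g := fun r x => x + m • α r)
      (measurable_from_prod_countable_right fun r => ?_) (ae_of_all _ fun r => ?_)
    · exact measurable_add_const (m • α r)
    · exact (measurePreserving_add_right volume (m • α r)).map_eq
  obtain ⟨T, hT⟩ := exists_forall_zpow_ae_eq hP hP' (fun y => by simp)
    (by filter_upwards [ofCircle_toCircle] with z hz; simpa using hz) hF
    (fun y => by simp [F]) (fun m n y => by
      simp [F, add_zsmul, add_assoc, add_comm (m • α y.1)])
  have hcell : ∀ z, cell q z = towerColour M π (e (toCircle z)).2 := fun z =>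
    Fin.ext ((cell_eq_div q M z).trans (hcol _).symm)
  refine ⟨T, fun m S => ?_⟩
  have hS : MeasurableSet {y : Fin R × UnitAddCircle |
      (towerColour M π y.2, towerColour M π (F m y).2) ∈ S} :=
    (((measurable_towerColour π).comp measurable_snd).prodMk
      ((measurable_towerColour π).comp (measurable_snd.comp (hF m).measurable)))
      S.toFinite.measurableSet
  refine Eq.trans ?_ (measureReal_unifFin_prod hS)
  rw [← hP.measureReal_preimage hS.nullMeasurableSet]
  refine measureReal_congr ?_
  filter_upwards [hT m] with z hz
  refine propext ?_
  change (cell q z, cell q ((T.toEquiv ^ m : Equiv.Perm I) z)) ∈ S ↔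
    (towerColour M π (e (toCircle z)).2, towerColour M π (F m (e (toCircle z))).2) ∈ S
  rw [Function.comp_apply, Function.comp_apply] at hz
  rw [hcell, hcell, hz]

theorem corr_cell_eq (T : Aut01) (m : ℤ) {q : ℕ} [NeZero q] (A B : Set (Fin q)) :
    T.corr m (cell q ⁻¹' A) (cell q ⁻¹' B) =
      volume.real {z | (cell q z, cell q ((T.toEquiv ^ m : Equiv.Perm I) z)) ∈ A ×ˢ B} := rfl

/-- Up to a small error, a transformation may permute a partition arbitrarily and have prescribed
correlations at some large time. -/
theorem exists_perm_cell_and_corr {κ : Type*} [Fintype κ] {lam : κ → ℝ}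
    (hlam : ∀ j, lam j ∈ Set.Icc (0 : ℝ) 1) {φ : κ → ℕ → ℤ}
    (hφ : ∀ a : κ → ℤ, a ≠ 0 → Tendsto (fun n => |∑ j, a j * φ j n|) atTop atTop)
    {q : ℕ} [NeZero q] (π : Equiv.Perm (Fin q)) {ε : ℝ} (hε : 0 < ε) (n₀ : ℕ) :
    ∃ T : Aut01, volume.real {z | cell q (T.toEquiv z) ≠ π (cell q z)} < ε ∧
      ∃ n ≥ n₀, ∀ j, ∀ A B : Set (Fin q),
        |T.corr (φ j n) (cell q ⁻¹' A) (cell q ⁻¹' B) -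
          ((1 - lam j) * volume.real (cell q ⁻¹' A ∩ cell q ⁻¹' B) +
            lam j * volume.real (cell q ⁻¹' A) * volume.real (cell q ⁻¹' B))| < ε := by
  obtain ⟨M', hM'⟩ := exists_nat_one_div_lt hε
  let M := M' + 1
  have : NeZero (q * M) := ⟨mul_ne_zero (NeZero.ne q) M'.succ_ne_zero⟩
  have hκ := measurable_towerColour (M := M) π
  let G : Set (Fin q × Fin q) → UnitAddCircle → ℝ := fun S s =>
    volume.real {x | (towerColour M π x, towerColour M π (x + s)) ∈ S}
  have hG : ∀ S, Continuous (G S) := continuous_volume_pair hκ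
  let D : Set (Fin q × Fin q) := {p | p.2 ≠ π p.1}
  have hD : G D ((1 / (q * M : ℕ) : ℝ) : UnitAddCircle) < ε :=
    (volume_towerColour_add_inv_ne_le π).trans_lt (by simpa [M] using hM')
  obtain ⟨δ, hδ, hδD⟩ : ∃ δ > 0, ∀ a ∈ Set.Icc (1 / (q * M : ℕ) : ℝ) (1 / (q * M : ℕ) + δ),
      G D (a : UnitAddCircle) < ε := by
    have h1 : ∀ᶠ a : ℝ in 𝓝 (1 / (q * M : ℕ) : ℝ), G D (a : UnitAddCircle) < ε :=
      (((hG D).comp (AddCircle.continuous_mk' 1)).tendsto _).eventually_lt_const hD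
    obtain ⟨δ, hδ, h2⟩ := Metric.eventually_nhds_iff.1 h1
    refine ⟨δ / 2, half_pos hδ, fun a ha => h2 ?_⟩
    rw [Real.dist_eq, abs_lt]
    constructor <;> linarith [ha.1, ha.2]
  obtain ⟨R, hR, θ, hθ⟩ := UnitAddCircle.exists_average_sub_lt hlam
    (g := fun p : Set (Fin q) × Set (Fin q) => G (p.1 ×ˢ p.2)) (fun p => hG _) (half_pos hε)
  have : NeZero R := ⟨hR.ne'⟩
  obtain ⟨η, hη, hηG⟩ : ∃ η > 0, ∀ p : Set (Fin q) × Set (Fin q), ∀ x y, dist x y < η →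
      |G (p.1 ×ˢ p.2) x - G (p.1 ×ˢ p.2) y| < ε / 2 := by
    have h1 : ∀ p : Set (Fin q) × Set (Fin q), ∀ᶠ η in 𝓝[>] (0 : ℝ), ∀ x y, dist x y < η →
        |G (p.1 ×ˢ p.2) x - G (p.1 ×ˢ p.2) y| < ε / 2 := by
      intro p
      obtain ⟨η, hη, h2⟩ := Metric.uniformContinuous_iff.1
        (CompactSpace.uniformContinuous_of_continuous (hG (p.1 ×ˢ p.2))) _ (half_pos hε)
      filter_upwards [Ioo_mem_nhdsGT hη] with b hb x y hxy using h2 (hxy.trans hb.2)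
    obtain ⟨η, hη⟩ := ((eventually_all.2 h1).and self_mem_nhdsWithin).exists
    exact ⟨η, hη.2, hη.1⟩
  have h1 : ∀ᶠ n in atTop, ∀ r : Fin R,
      ∃ a ∈ Set.Icc (1 / (q * M : ℕ) : ℝ) (1 / (q * M : ℕ) + δ),
        ∀ j, dist (φ j n • (a : UnitAddCircle)) (θ r j) < η :=
    eventually_all.2 fun r => UnitAddTorus.eventually_exists_forall_dist_zsmul_lt hφ
      (lt_add_of_pos_right _ hδ) (θ r) hη
  obtain ⟨n, hn, hn₀⟩ := (h1.and (eventually_ge_atTop n₀)).exists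
  choose a ha haθ using hn
  obtain ⟨T, hT⟩ := exists_forall_volume_cell_pair (M := M) π fun r => (a r : UnitAddCircle)
  have hR' : (0 : ℝ) < R := by exact_mod_cast hR
  have havg : ∀ (u v : Fin R → ℝ) (b : ℝ), (∀ r, |u r - v r| < b) →
      |(R : ℝ)⁻¹ * ∑ r, u r - (R : ℝ)⁻¹ * ∑ r, v r| < b := by
    intro u v b h
    rw [← mul_sub, ← Finset.sum_sub_distrib, abs_mul, abs_of_pos (inv_pos.2 hR'),
      inv_mul_lt_iff₀ hR']
    refine (Finset.abs_sum_le_sum_abs _ _).trans_lt ?_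
    refine (Finset.sum_lt_sum_of_nonempty Finset.univ_nonempty fun r _ => h r).trans_eq ?_
    simp
  refine ⟨T, ?_, n, hn₀, fun j A B => ?_⟩
  · have h2 := hT 1 D
    rw [zpow_one] at h2
    refine lt_of_eq_of_lt h2 ?_
    have h3 := havg (fun r => G D (a r)) 0 ε fun r => by
      rw [Pi.zero_apply, sub_zero, abs_of_nonneg measureReal_nonneg]
      exact hδD _ (ha r)
    simp only [Pi.zero_apply, Finset.sum_const_zero, mul_zero, sub_zero] at h3
    simpa only [G, one_zsmul] using (le_abs_self _).trans_lt h3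
  · have hcell : ∀ S : Set (Fin q × Fin q),
        volume.real {z | (cell q z, cell q z) ∈ S} = G S 0 := by
      intro S
      have h2 := hT 0 S
      simpa [G, hR'.ne'] using h2
    have hone : ∀ A : Set (Fin q), volume.real (cell q ⁻¹' A) =
        volume.real (towerColour M π ⁻¹' A) := by
      intro A
      have h2 := hcell (Prod.fst ⁻¹' A)
      exact h2
    have h3 : volume.real (cell q ⁻¹' A ∩ cell q ⁻¹' B) = G (A ×ˢ B) 0 :=
      hcell (A ×ˢ B)
    have h4 := hθ (A, B) j
    simp only [G, integral_volume_pair hκ] at h4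
    rw [corr_cell_eq, hT, h3, hone A, hone B, mul_assoc]
    have h5 := havg (fun r => G (A ×ˢ B) (φ j n • (a r : UnitAddCircle)))
      (fun r => G (A ×ˢ B) (θ r j)) (ε / 2) fun r => hηG (A, B) _ _ (haθ r j)
    simp only [G] at h5 ⊢
    rw [abs_lt] at h4 h5 ⊢
    constructor <;> linarith [h4.1, h4.2, h5.1, h5.2]

end Aut01

/-- Two colourings of a finite set can be matched by a permutation as well as the sizes of their
colour classes allow. -/
theorem exists_perm_card_ne_le {ι K : Type*} [Fintype ι] [DecidableEq ι] [Fintype K]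
    [DecidableEq K] (c d : ι → K) :
    ∃ π : Equiv.Perm ι, (Finset.univ.filter fun i => d (π i) ≠ c i).card ≤
      ∑ a, ((Finset.univ.filter fun i => c i = a).card -
        (Finset.univ.filter fun i => d i = a).card) := by
  obtain ⟨π, -, hπ⟩ := Finset.exists_min_image (Finset.univ : Finset (Equiv.Perm ι))
    (fun π => (Finset.univ.filter fun i => d (π i) ≠ c i).card) Finset.univ_nonempty
  refine ⟨π, ?_⟩
  rw [Finset.card_eq_sum_card_fiberwise (f := c) (t := Finset.univ) (fun _ _ => Finset.mem_univ _)]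
  refine Finset.sum_le_sum fun a _ => ?_
  rcases Finset.eq_empty_or_nonempty
    ((Finset.univ.filter fun i => d (π i) ≠ c i).filter fun i => c i = a) with h0 | ⟨i, hi⟩
  · simp [h0]
  simp only [Finset.mem_filter, Finset.mem_univ, true_and] at hi
  obtain ⟨hi, rfl⟩ := hi
  have key : ∀ j, d (π j) = c i → c j = c i := by
    intro j hj
    by_contra hji
    have hlt : (Finset.univ.filter fun k => d ((π * Equiv.swap i j) k) ≠ c k) ⊂
        (Finset.univ.filter fun k => d (π k) ≠ c k) := by
      refine Finset.ssubset_iff_of_subset (fun k hk => ?_) |>.2 ⟨i, ?_, ?_⟩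
      · rw [Finset.mem_filter_univ] at hk ⊢
        rw [Equiv.Perm.mul_apply] at hk
        rcases eq_or_ne k i with rfl | hki
        · exact hi
        rcases eq_or_ne k j with rfl | hkj
        · rw [hj]; exact Ne.symm hji
        rwa [Equiv.swap_apply_of_ne_of_ne hki hkj] at hk
      · simpa using hi
      · rw [Finset.mem_filter_univ, Equiv.Perm.mul_apply, Equiv.swap_apply_left]
        exact fun h => h hj
    exact absurd (hπ (π * Equiv.swap i j) (Finset.mem_univ _)) (not_le.2 (Finset.card_lt_card hlt))
  have h1 : (Finset.univ.filter fun j => d j = c i).card =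
      (Finset.univ.filter fun j => d (π j) = c i).card := by
    refine (Finset.card_equiv π fun j => ?_).symm
    simp
  rw [h1, ← Finset.card_sdiff_of_subset]
  · refine Finset.card_le_card fun j hj => ?_
    simp only [Finset.mem_filter, Finset.mem_univ, true_and, Finset.mem_sdiff] at hj ⊢
    exact ⟨hj.2, hj.2 ▸ hj.1⟩
  · intro j hj
    simp only [Finset.mem_filter, Finset.mem_univ, true_and] at hj ⊢
    exact key j hj

namespace unitInterval

theorem exists_cell_eq_comp {L q : ℕ} [NeZero L] [NeZero q] (h : L ∣ q) :
    ∃ f : Fin q → Fin L, ∀ z, cell L z = f (cell q z) := by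
  obtain ⟨s, rfl⟩ := h
  refine ⟨fun i => ⟨(i : ℕ) / s, Nat.div_lt_of_lt_mul (by rw [mul_comm s]; exact i.2)⟩,
    fun z => Fin.ext (cell_eq_div L s z)⟩

/-- Finite measurable partitions are approximated by partitions into unions of cells. -/
theorem exists_volume_cell_ne_lt {K : Type*} [Finite K] [Nonempty K] [MeasurableSpace K]
    [MeasurableSingletonClass K] {e : I → K} (he : Measurable e) {η : ℝ} (hη : 0 < η) :
    ∃ q₀ : ℕ, ∀ q ≥ q₀, ∀ [NeZero q], ∃ d : Fin q → K,
      volume.real {y | d (cell q y) ≠ e y} < η := by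
  have := Fintype.ofFinite K
  have hK : (0 : ℝ) < Fintype.card K := by exact_mod_cast Fintype.card_pos
  have h1 : ∀ a, ∃ C ⊆ e ⁻¹' {a}, IsCompact C ∧
      volume (e ⁻¹' {a} \ C) < ENNReal.ofReal (η / Fintype.card K) := fun a =>
    (he (measurableSet_singleton a)).exists_isCompact_sdiff_lt (measure_ne_top _ _)
      (ENNReal.ofReal_pos.2 (div_pos hη hK)).ne'
  choose C hCe hC hCη using h1
  have h2 : ∀ᶠ r in 𝓝[>] (0 : ℝ), ∀ a b, a ≠ b → ∀ x ∈ C a, ∀ y ∈ C b, r < dist x y := by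
    refine eventually_all.2 fun a => eventually_all.2 fun b => ?_
    by_cases hab : a = b
    · simp [hab]
    obtain ⟨r, hr, h⟩ := Metric.exists_pos_forall_lt_edist (hC a) (hC b).isClosed
      (Set.disjoint_left.2 fun x hx hy => hab ((hCe a hx).symm.trans (hCe b hy)))
    filter_upwards [Ioo_mem_nhdsGT (NNReal.coe_pos.2 hr)] with t ht _ x hx y hy
    refine ht.2.trans ?_
    have := h x hx y hy
    rw [edist_nndist] at this
    exact_mod_cast this
  obtain ⟨r, hr, hr0⟩ := (h2.and self_mem_nhdsWithin).exists
  obtain ⟨n, hn⟩ := exists_nat_one_div_lt hr0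
  refine ⟨n + 1, fun q hq _ => ?_⟩
  have hqr : (1 : ℝ) / q < r := by
    refine lt_of_le_of_lt (one_div_le_one_div_of_le (by positivity) ?_) hn
    exact_mod_cast hq
  have h3 : ∀ i : Fin q, ∃ a, ∀ b, ∀ y ∈ C b, y ≠ 1 → cell q y = i → b = a := by
    intro i
    by_cases h : ∃ a, ∃ y ∈ C a, y ≠ 1 ∧ cell q y = i
    · obtain ⟨a, y, hy, hy1, hyi⟩ := h
      refine ⟨a, fun b z hz hz1 hzi => ?_⟩
      by_contra hba
      have := hr b a hba z hz y hy
      exact absurd (dist_le_of_cell_eq hz1 hy1 (hzi.trans hyi.symm)) (not_le.2 (hqr.trans this))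
    · refine ⟨Classical.arbitrary K, fun b y hy hy1 hyi => absurd ⟨b, y, hy, hy1, hyi⟩ h⟩
  choose d hd using h3
  refine ⟨d, ?_⟩
  have h4 : volume.real {y | d (cell q y) ≠ e y} ≤ volume.real (⋃ a, e ⁻¹' {a} \ C a) := by
    refine ENNReal.toReal_mono (measure_ne_top _ _) (measure_mono_ae ?_)
    filter_upwards [ae_ne_one] with y hy1 hy
    refine Set.mem_iUnion.2 ⟨e y, rfl, fun hyC => hy ?_⟩
    exact (hd _ _ y hyC hy1 rfl).symm
  refine (h4.trans (measureReal_iUnion_fintype_le _)).trans_lt ?_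
  refine (Finset.sum_lt_sum_of_nonempty Finset.univ_nonempty (g := fun _ => η / Fintype.card K)
    fun a _ => ?_).trans_eq ?_
  · exact ENNReal.toReal_lt_of_lt_ofReal (hCη a)
  · simp [mul_div_cancel₀ _ hK.ne']

end unitInterval

namespace Aut01

open unitInterval

theorem exists_forall_volume_perm_cell_ne_lt_imp_mem {T₀ : Aut01} {U : Set Aut01} (hU : U ∈ 𝓝 T₀) :
    ∃ K q₀ : ℕ, 0 < K ∧ ∀ q ≥ q₀, K ∣ q → ∀ [NeZero q], ∃ π : Equiv.Perm (Fin q), ∃ ε > 0,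
      ∀ T : Aut01, volume.real {z | cell q (T.toEquiv z) ≠ π (cell q z)} < ε → T ∈ U := by
  obtain ⟨δ, hδ, hδU⟩ := exists_integral_dist_symm_lt_imp_mem hU
  obtain ⟨K', hK'⟩ := exists_nat_one_div_lt (half_pos hδ)
  let K := K' + 1
  let e : I → Fin K := fun y => cell K (T₀.toEquiv.symm y)
  have he : Measurable e := measurable_cell.comp T₀.measurable_symm
  have hη : 0 < δ / (4 * (K + 1)) := by positivity
  obtain ⟨q₀, hq₀⟩ := exists_volume_cell_ne_lt he hη
  refine ⟨K, q₀, K'.succ_pos, fun q hq hKq _ => ?_⟩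
  obtain ⟨d, hd⟩ := hq₀ q hq
  obtain ⟨c, hc⟩ : ∃ c : Fin q → Fin K, ∀ z, cell K z = c (cell q z) := exists_cell_eq_comp hKq
  have hqpos : (0 : ℝ) < q := by exact_mod_cast NeZero.pos q
  obtain ⟨π, hπ⟩ := exists_perm_card_ne_le c d
  refine ⟨π, δ / 4, by positivity, fun T hT => hδU T ?_⟩
  have hcellcard : ∀ p : Fin q → Prop, ∀ [DecidablePred p],
      volume.real {z | p (cell q z)} = (q : ℝ)⁻¹ * (Finset.univ.filter p).card := by
    intro p _
    rw [← measureReal_unifFin, ← measurePreserving_cell.measureReal_preimage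
      (Finset.measurableSet _).nullMeasurableSet]
    simp [Set.preimage]
  have hclass : ∀ a, (q : ℝ)⁻¹ * ((Finset.univ.filter fun i => c i = a).card -
      (Finset.univ.filter fun i => d i = a).card : ℕ) ≤ δ / (4 * (K + 1)) := by
    intro a
    have h1 : volume.real {z | c (cell q z) = a} = volume.real {y | e y = a} := by
      have := T₀.measurePreserving_invFun.measureReal_preimage
        (measurable_cell (q := K) (measurableSet_singleton a)).nullMeasurableSet
      simp only [← hc]
      exact this.symm
    have h2 : volume.real {y | e y = a} ≤
        volume.real {y | d (cell q y) = a} + volume.real {y | d (cell q y) ≠ e y} := by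
      refine (measureReal_mono fun y (hy : e y = a) => ?_).trans (measureReal_union_le _ _)
      by_cases h : d (cell q y) = e y
      · exact Or.inl (h.trans hy)
      · exact Or.inr h
    rw [← h1, hcellcard fun i => c i = a, hcellcard fun i => d i = a] at h2
    rcases le_total (Finset.univ.filter fun i => c i = a).card
      (Finset.univ.filter fun i => d i = a).card with h | h
    · rw [Nat.sub_eq_zero_of_le h]
      simpa using hη.le
    · rw [Nat.cast_sub h, mul_sub]
      linarith
  have hbad : volume.real {z | d (π (cell q z)) ≠ c (cell q z)} ≤ K * (δ / (4 * (K + 1))) := by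
    rw [hcellcard fun i => d (π i) ≠ c i]
    calc (q : ℝ)⁻¹ * (Finset.univ.filter fun i => d (π i) ≠ c i).card
        ≤ (q : ℝ)⁻¹ * ((∑ a, ((Finset.univ.filter fun i => c i = a).card -
          (Finset.univ.filter fun i => d i = a).card) : ℕ) : ℝ) := by gcongr
      _ = ∑ a, (q : ℝ)⁻¹ * ((Finset.univ.filter fun i => c i = a).card -
          (Finset.univ.filter fun i => d i = a).card : ℕ) := by
        rw [Nat.cast_sum, Finset.mul_sum]
      _ ≤ ∑ _a : Fin K, δ / (4 * (K + 1)) := Finset.sum_le_sum fun a _ => hclass a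
      _ = K * (δ / (4 * (K + 1))) := by simp
  have hmeas : MeasurableSet {y | cell K (T.toEquiv.symm y) ≠ e y} :=
    ((measurable_cell.comp T.measurable_symm).prodMk he)
      (Set.toFinite {p : Fin K × Fin K | p.1 ≠ p.2}).measurableSet
  have hdmeas : MeasurableSet {y | d (cell q y) ≠ e y} :=
    (((measurable_of_finite d).comp measurable_cell).prodMk he)
      (Set.toFinite {p : Fin K × Fin K | p.1 ≠ p.2}).measurableSet
  have hvol : volume.real {y | cell K (T.toEquiv.symm y) ≠ e y} < δ / 4 + δ / 4 := by
    rw [← T.measurePreserving_toFun.measureReal_preimage hmeas.nullMeasurableSet]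
    have h1 : volume.real (T.toEquiv ⁻¹' {y | cell K (T.toEquiv.symm y) ≠ e y}) ≤
        volume.real {z | cell q (T.toEquiv z) ≠ π (cell q z)} +
          volume.real {z | d (π (cell q z)) ≠ c (cell q z)} +
          volume.real (T.toEquiv ⁻¹' {y | d (cell q y) ≠ e y}) := by
      refine (measureReal_mono fun z hz => ?_).trans ((measureReal_union_le _ _).trans
        (add_le_add_left (measureReal_union_le _ _) _))
      by_contra h
      simp only [Set.mem_union, Set.mem_ofPred_eq, Set.mem_preimage, not_or, not_not, ne_eq,
        Equiv.symm_apply_apply, hc] at h hz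
      exact hz (h.1.2.symm.trans ((congrArg d h.1.1.symm).trans h.2))
    rw [T.measurePreserving_toFun.measureReal_preimage hdmeas.nullMeasurableSet] at h1
    have h2 : (K : ℝ) * (δ / (4 * (K + 1))) + δ / (4 * (K + 1)) = δ / 4 := by field_simp
    linarith
  have hint := integrable_dist (μ := volume) T.measurable_symm.aemeasurable
    T₀.measurable_symm.aemeasurable
  calc ∫ y, dist (T.toEquiv.symm y) (T₀.toEquiv.symm y)
      ≤ ∫ y, ((1 : ℝ) / K +
          Set.indicator {y | cell K (T.toEquiv.symm y) ≠ e y} (fun _ => (1 : ℝ)) y) := by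
        refine integral_mono_ae hint ((integrable_const _).add
          ((integrable_const _).indicator hmeas)) ?_
        filter_upwards [T.measurePreserving_invFun.quasiMeasurePreserving.ae ae_ne_one,
          T₀.measurePreserving_invFun.quasiMeasurePreserving.ae ae_ne_one] with y h1 h2
        by_cases h : cell K (T.toEquiv.symm y) = e y
        · have := dist_le_of_cell_eq h1 h2 h
          simpa [h] using this
        · have h3 : dist (T.toEquiv.symm y) (T₀.toEquiv.symm y) ≤ 1 := by
            rw [Subtype.dist_eq]
            exact Real.dist_le_of_mem_Icc_01 (T.toEquiv.symm y).2 (T₀.toEquiv.symm y).2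
          have h4 : (0 : ℝ) ≤ 1 / K := by positivity
          simp only [Set.indicator, Set.mem_ofPred_eq, ne_eq, h, not_false_eq_true, if_true]
          linarith
    _ = 1 / K + volume.real {y | cell K (T.toEquiv.symm y) ≠ e y} := by
        rw [integral_add (integrable_const _) ((integrable_const _).indicator hmeas),
          integral_indicator_const _ hmeas]
        simp
    _ < δ := by
        have : (1 : ℝ) / K < δ / 2 := by simpa [K] using hK'
        linarith

end Aut01

theorem abs_measureReal_inter_sub_le {α : Type*} [MeasurableSpace α] {μ : Measure α}
    [IsFiniteMeasure μ] {A A' B B' : Set α} (hA : MeasurableSet A) (hA' : MeasurableSet A')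
    (hB : MeasurableSet B) (hB' : MeasurableSet B') :
    |μ.real (A ∩ B) - μ.real (A' ∩ B')| ≤ μ.real (symmDiff A A') + μ.real (symmDiff B B') := by
  refine (abs_measureReal_sub_le_measureReal_symmDiff (hA.inter hB).nullMeasurableSet
    (hA'.inter hB').nullMeasurableSet).trans ?_
  refine (measureReal_mono fun x hx => ?_).trans (measureReal_union_le _ _)
  simp only [Set.mem_symmDiff, Set.mem_inter_iff, Set.mem_union] at hx ⊢
  tauto

theorem unitInterval.exists_volume_symmDiff_cell_lt {A : Set I} (hA : MeasurableSet A) {η : ℝ}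
    (hη : 0 < η) :
    ∃ q₀ : ℕ, ∀ q ≥ q₀, ∀ [NeZero q], ∃ F : Set (Fin q),
      volume.real (symmDiff A (cell q ⁻¹' F)) < η := by
  obtain ⟨q₀, h⟩ := exists_volume_cell_ne_lt (e := fun y => y ∈ A) hA.mem hη
  refine ⟨q₀, fun q hq _ => ?_⟩
  obtain ⟨d, hd⟩ := h q hq
  refine ⟨{i | d i}, ?_⟩
  convert hd using 2
  ext y
  by_cases h1 : y ∈ A <;> by_cases h2 : d (cell q y) <;> simp [Set.mem_symmDiff, h1, h2]

namespace Aut01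

open unitInterval

/-- The value at `A`, `B` of the convex combination with weights `1 - l`, `l` of the correlations
of the identity and of independence. -/
def mixedCorr (l : ℝ) (A B : Set I) : ℝ :=
  (1 - l) * volume.real (A ∩ B) + l * volume.real A * volume.real B

theorem abs_corr_sub_corr_le (T : Aut01) (m : ℤ) {A A' B B' : Set I} (hA : MeasurableSet A)
    (hA' : MeasurableSet A') (hB : MeasurableSet B) (hB' : MeasurableSet B') :
    |T.corr m A B - T.corr m A' B'| ≤
      volume.real (symmDiff A A') + volume.real (symmDiff B B') := by
  have hT := T.measurePreserving_zpow m
  have h := abs_measureReal_inter_sub_le (μ := volume) hA hA' (hT.measurable hB)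
    (hT.measurable hB')
  rwa [← Set.preimage_symmDiff, hT.measureReal_preimage (hB.symmDiff hB').nullMeasurableSet] at h

theorem abs_mixedCorr_sub_le {l : ℝ} (hl : l ∈ Set.Icc (0 : ℝ) 1) {A A' B B' : Set I}
    (hA : MeasurableSet A) (hA' : MeasurableSet A') (hB : MeasurableSet B)
    (hB' : MeasurableSet B') :
    |mixedCorr l A B - mixedCorr l A' B'| ≤
      volume.real (symmDiff A A') + volume.real (symmDiff B B') := by
  have h1 := abs_measureReal_inter_sub_le (μ := volume) hA hA' hB hB'
  have h2 := abs_measureReal_sub_le_measureReal_symmDiff (μ := volume) hA.nullMeasurableSet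
    hA'.nullMeasurableSet
  have h3 := abs_measureReal_sub_le_measureReal_symmDiff (μ := volume) hB.nullMeasurableSet
    hB'.nullMeasurableSet
  have h4 : |volume.real A * volume.real B - volume.real A' * volume.real B'| ≤
      volume.real (symmDiff A A') + volume.real (symmDiff B B') := by
    have : volume.real A * volume.real B - volume.real A' * volume.real B' =
        (volume.real A - volume.real A') * volume.real B +
          volume.real A' * (volume.real B - volume.real B') := by ring
    rw [this]
    refine (abs_add_le _ _).trans (add_le_add ?_ ?_)
    · rw [abs_mul, abs_of_nonneg (measureReal_nonneg (s := B))]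
      exact (mul_le_of_le_one_right (abs_nonneg _) measureReal_le_one).trans h2
    · rw [abs_mul, abs_of_nonneg (measureReal_nonneg (s := A'))]
      exact (mul_le_of_le_one_left (abs_nonneg _) measureReal_le_one).trans h3
  have h5 : mixedCorr l A B - mixedCorr l A' B' =
      (1 - l) * (volume.real (A ∩ B) - volume.real (A' ∩ B')) +
        l * (volume.real A * volume.real B - volume.real A' * volume.real B') := by
    simp only [mixedCorr]; ring
  rw [h5]
  refine (abs_add_le _ _).trans ?_
  rw [abs_mul, abs_mul, abs_of_nonneg hl.1, abs_of_nonneg (sub_nonneg.2 hl.2)]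
  nlinarith [mul_le_mul_of_nonneg_left h1 (sub_nonneg.2 hl.2), mul_le_mul_of_nonneg_left h4 hl.1]

variable {κ : Type*} {lam : κ → ℝ} {φ : κ → ℕ → ℤ}

/-- The transformations whose correlations at time `φ j n` on cells of length `1 / (M + 1)` are
close to the prescribed ones. -/
def approxSet (lam : κ → ℝ) (φ : κ → ℕ → ℤ) (M n : ℕ) : Set Aut01 :=
  {T | ∀ j, ∀ A B : Set (Fin (M + 1)),
    |T.corr (φ j n) (cell (M + 1) ⁻¹' A) (cell (M + 1) ⁻¹' B) -
      mixedCorr (lam j) (cell (M + 1) ⁻¹' A) (cell (M + 1) ⁻¹' B)| < 1 / (M + 1 : ℝ)}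

theorem measurableSet_cell_preimage {q : ℕ} [NeZero q] (A : Set (Fin q)) :
    MeasurableSet (cell q ⁻¹' A) := measurable_cell A.toFinite.measurableSet

theorem isOpen_approxSet [Finite κ] (lam : κ → ℝ) (φ : κ → ℕ → ℤ) (M n : ℕ) :
    IsOpen (approxSet lam φ M n) := by
  simp only [approxSet, Set.ofPred_forall]
  refine isOpen_iInter_of_finite fun j => isOpen_iInter_of_finite fun A =>
    isOpen_iInter_of_finite fun B => isOpen_lt ?_ continuous_const
  exact ((continuous_corr _ (measurableSet_cell_preimage A)
    (measurableSet_cell_preimage B)).sub continuous_const).abs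

theorem dense_iUnion_approxSet [Fintype κ] (hlam : ∀ j, lam j ∈ Set.Icc (0 : ℝ) 1)
    (hφ : ∀ a : κ → ℤ, a ≠ 0 → Tendsto (fun n => |∑ j, a j * φ j n|) atTop atTop) (M n₀ : ℕ) :
    Dense (⋃ n ≥ n₀, approxSet lam φ M n) := by
  intro T₀
  refine mem_closure_iff_nhds.2 fun U hU => ?_
  obtain ⟨K, q₀, hK, h⟩ := exists_forall_volume_perm_cell_ne_lt_imp_mem hU
  let q := K * (M + 1) * (q₀ + 1)
  have hq : NeZero q := ⟨by positivity⟩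
  have hq₀ : q ≥ q₀ := by
    exact q₀.le_succ.trans (Nat.le_mul_of_pos_left _ (by positivity))
  obtain ⟨π, ε, hε, hπ⟩ := h q hq₀ (by simp only [q, mul_assoc]; exact dvd_mul_right _ _)
  obtain ⟨f, hf⟩ := exists_cell_eq_comp (L := M + 1) (q := q)
    ((dvd_mul_left _ _).trans (dvd_mul_right _ _))
  have hpre : ∀ A : Set (Fin (M + 1)), cell (M + 1) ⁻¹' A = cell q ⁻¹' (f ⁻¹' A) := fun A => by
    ext z; simp [hf]
  have hM : (0 : ℝ) < 1 / (M + 1 : ℝ) := by positivity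
  obtain ⟨T, hT, n, hn, hTn⟩ := exists_perm_cell_and_corr hlam hφ π (lt_min hε hM) n₀
  refine ⟨T, hπ T (hT.trans_le (min_le_left _ _)), Set.mem_iUnion₂.2 ⟨n, hn, fun j A B => ?_⟩⟩
  rw [hpre, hpre]
  exact (hTn j _ _).trans_le (min_le_right _ _)

theorem exists_strictMono_tendsto_corr_eq [Finite κ] (hlam : ∀ j, lam j ∈ Set.Icc (0 : ℝ) 1)
    (φ : κ → ℕ → ℤ) :
    {T : Aut01 | ∃ n : ℕ → ℕ, StrictMono n ∧ ∀ j, ∀ A B : Set I,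
      MeasurableSet A → MeasurableSet B →
        Tendsto (fun k => T.corr (φ j (n k)) A B) atTop (𝓝 (mixedCorr (lam j) A B))} =
      ⋂ M : ℕ, ⋂ n₀ : ℕ, ⋃ n ≥ n₀, approxSet lam φ M n := by
  ext T
  simp only [Set.mem_iInter]
  constructor
  · rintro ⟨n, hn, h⟩ M n₀
    have h1 : ∀ᶠ k in atTop, T ∈ approxSet lam φ M (n k) := by
      refine eventually_all.2 fun j => eventually_all.2 fun A => eventually_all.2 fun B => ?_
      exact (h j _ _ (measurableSet_cell_preimage A) (measurableSet_cell_preimage B)).eventually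
        (Metric.ball_mem_nhds _ (by positivity))
    obtain ⟨k, hk, hk'⟩ := (h1.and (hn.tendsto_atTop.eventually_ge_atTop n₀)).exists
    exact Set.mem_iUnion₂.2 ⟨n k, hk', hk⟩
  · intro h
    have h1 : ∀ M, ∃ᶠ n in atTop, T ∈ approxSet lam φ M n := fun M =>
      frequently_atTop.2 fun n₀ => by
        obtain ⟨n, hn, hn'⟩ := Set.mem_iUnion₂.1 (h M n₀)
        exact ⟨n, hn, hn'⟩
    obtain ⟨n, hn, hn'⟩ := extraction_forall_of_frequently h1
    refine ⟨n, hn, fun j A B hA hB => ?_⟩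
    rw [Metric.tendsto_atTop]
    intro ε hε
    obtain ⟨qA, hqA⟩ := exists_volume_symmDiff_cell_lt hA (η := ε / 8) (by positivity)
    obtain ⟨qB, hqB⟩ := exists_volume_symmDiff_cell_lt hB (η := ε / 8) (by positivity)
    obtain ⟨M₀, hM₀⟩ := exists_nat_one_div_lt (half_pos hε)
    refine ⟨max M₀ (max qA qB), fun M hM => ?_⟩
    simp only [ge_iff_le, max_le_iff] at hM
    obtain ⟨F, hF⟩ := hqA (M + 1) (by omega)
    obtain ⟨F', hF'⟩ := hqB (M + 1) (by omega)
    have h2 := hn' M j F F'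
    have h3 := T.abs_corr_sub_corr_le (φ j (n M)) hA (measurableSet_cell_preimage F) hB
      (measurableSet_cell_preimage F')
    have h4 := abs_mixedCorr_sub_le (hlam j) hA (measurableSet_cell_preimage F) hB
      (measurableSet_cell_preimage F')
    have h5 : (1 : ℝ) / (M + 1) ≤ 1 / (M₀ + 1) := by
      have : (M₀ : ℝ) ≤ M := by exact_mod_cast hM.1
      exact one_div_le_one_div_of_le (by positivity) (by linarith)
    rw [Real.dist_eq]
    rw [abs_lt] at h2 ⊢
    rw [abs_le] at h3 h4
    constructor <;> linarith [h2.1, h2.2, h3.1, h3.2, h4.1, h4.2]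

theorem isGδ_and_dense [Fintype κ] (hlam : ∀ j, lam j ∈ Set.Icc (0 : ℝ) 1)
    (hφ : ∀ a : κ → ℤ, a ≠ 0 → Tendsto (fun n => |∑ j, a j * φ j n|) atTop atTop) :
    IsGδ (⋂ M : ℕ, ⋂ n₀ : ℕ, ⋃ n ≥ n₀, approxSet lam φ M n) ∧
      Dense (⋂ M : ℕ, ⋂ n₀ : ℕ, ⋃ n ≥ n₀, approxSet lam φ M n) := by
  have hopen : ∀ M n₀ : ℕ, IsOpen (⋃ n ≥ n₀, approxSet lam φ M n) := fun M n₀ =>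
    isOpen_biUnion fun n _ => isOpen_approxSet lam φ M n
  have hGδ : ∀ M, IsGδ (⋂ n₀ : ℕ, ⋃ n ≥ n₀, approxSet lam φ M n) := fun M =>
    IsGδ.iInter_of_isOpen (hopen M)
  exact ⟨IsGδ.iInter hGδ, dense_iInter_of_Gδ hGδ fun M =>
    dense_iInter_of_isOpen (hopen M) fun n₀ => dense_iUnion_approxSet hlam hφ M n₀⟩

end Aut01

end

/-- For `λ_1,…,λ_N ∈ [0,1]` and asymptotically linearly independent
`φ_1,…,φ_N : ℕ → ℤ`, the set of `T ∈ Aut([0,1],ℬ,μ)` admitting a strictly increasing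
sequence `(n_k)` with `μ(A ∩ T^{-φ_j(n_k)}B) → (1-λ_j)μ(A∩B) + λ_j μ(A)μ(B)` for all
`j` and all measurable `A,B` is a dense `G_δ` in the weak topology. -/
theorem stmt_0 (N : ℕ) (lam : Fin N → ℝ) (hlam : ∀ j, lam j ∈ Set.Icc (0 : ℝ) 1)
    (φ : Fin N → ℕ → ℤ)
    (hφ : ∀ a : Fin N → ℤ, a ≠ 0 →
      Tendsto (fun n => |∑ j, a j * φ j n|) atTop atTop) :
    IsGδ {T : Aut01 | ∃ n : ℕ → ℕ, StrictMono n ∧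
        ∀ j : Fin N, ∀ A B : Set unitInterval, MeasurableSet A → MeasurableSet B →
          Tendsto (fun k => T.corr (φ j (n k)) A B) atTop
            (𝓝 ((1 - lam j) * (volume (A ∩ B)).toReal
              + lam j * (volume A).toReal * (volume B).toReal))} ∧
    Dense {T : Aut01 | ∃ n : ℕ → ℕ, StrictMono n ∧
        ∀ j : Fin N, ∀ A B : Set unitInterval, MeasurableSet A → MeasurableSet B →
          Tendsto (fun k => T.corr (φ j (n k)) A B) atTop
            (𝓝 ((1 - lam j) * (volume (A ∩ B)).toReal
              + lam j * (volume A).toReal * (volume B).toReal))} := by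
  have h := Aut01.isGδ_and_dense hlam hφ
  rwa [← Aut01.exists_strictMono_tendsto_corr_eq hlam φ] at h
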